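/- Main theorem: Let r ∈ ℕ₀, m ∈ ℕ, m ≥ r+1, and x_0 ≤ x_1 ≤ ... ≤ x_m with x_j < x_{j+r+1} for all 0 ≤ j ≤ m-r-1. If f ∈ C^{(r)}[x_0, x_m], then |[x_0,...,x_m; f]| ≤ c · Λ_r(x_0,...,x_m; ω_k), where k = m - r, ω_k(t) = ω_k(f^{(r)}, t; [x_0,x_m]), and c depends only on m. -/

import Mathlib

open scoped BigOperators

open Classical in
/-- Divided difference with possibly repeated knots, via derivative data `F`
(`F j` is the `j`-th derivative). -/
noncomputable def divDiff (F : ℕ → ℝ → ℝ) : List ℝ → ℝ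
  | [] => 0
  | [x] => F 0 x
  | x :: y :: l =>
      if h : ∀ z ∈ y :: l, z = x then
        F ((y :: l).length) x / Nat.factorial ((y :: l).length)
      else
        (divDiff F (y :: l) -
          divDiff F (x :: (y :: l).eraseIdx ((y :: l).findIdx (fun z => z ≠ x)))) /
          ((y :: l).getD ((y :: l).findIdx (fun z => z ≠ x)) 0 - x)
termination_by l => l.length
decreasing_by
  · simp
  · push_neg at h
    obtain ⟨z, hz, hzx⟩ := h
    have hlt : (y :: l).findIdx (fun z => decide (z ≠ x)) < (y :: l).length :=
      List.findIdx_lt_length_of_exists ⟨z, hz, by simpa using hzx⟩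
    simp only [List.length_cons, List.length_eraseIdx] at *
    rw [if_pos hlt]; omega

/-- Newton form of the Hermite interpolation polynomial at the knots `xs`. -/
noncomputable def newtonSum (F : ℕ → ℝ → ℝ) (xs : List ℝ) (t : ℝ) : ℝ :=
  ∑ j ∈ Finset.range xs.length,
    divDiff F (xs.take (j + 1)) * ∏ i ∈ Finset.range j, (t - xs.getD i 0)

/-- The `k`-th symmetric difference of `g`, set to `0` when the relevant points
leave `[a,b]`. -/
noncomputable def kSymmDiff (k : ℕ) (g : ℝ → ℝ) (u x a b : ℝ) : ℝ :=
  if a ≤ x - (k / 2 : ℝ) * u ∧ x + (k / 2 : ℝ) * u ≤ b then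
    ∑ i ∈ Finset.range (k + 1), (-1 : ℝ) ^ i * (k.choose i) * g (x + ((k : ℝ) / 2 - i) * u)
  else 0

/-- The `k`-th modulus of smoothness of `g` on `[a,b]`. -/
noncomputable def smoothOmega (k : ℕ) (g : ℝ → ℝ) (t a b : ℝ) : ℝ :=
  sSup {v : ℝ | ∃ u x : ℝ, 0 < u ∧ u ≤ t ∧ v = |kSymmDiff k g u x a b|}

/-- First modulus of continuity of `g` on `[a,b]`. -/
noncomputable def omega1 (g : ℝ → ℝ) (t a b : ℝ) : ℝ :=
  sSup {v : ℝ | ∃ x y : ℝ, x ∈ Set.Icc a b ∧ y ∈ Set.Icc a b ∧ |x - y| ≤ t ∧ v = |g x - g y|}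

/-- Sup norm on `[a,b]`. -/
noncomputable def supNorm (g : ℝ → ℝ) (a b : ℝ) : ℝ :=
  sSup {v : ℝ | ∃ x ∈ Set.Icc a b, v = |g x|}

/-- The knots extended by `x₋₁ = x₀ - (xₘ - x₀)` and `x_{m+1} = xₘ + (xₘ - x₀)`. -/
noncomputable def xExt (m : ℕ) (x : ℕ → ℝ) : ℤ → ℝ := fun i =>
  if i < 0 then x 0 - (x m - x 0) else if (m : ℤ) < i then x m + (x m - x 0) else x i.toNat

/-- `d(p,q) = min (x_{q+1} - x_p) (x_q - x_{p-1})`. -/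
noncomputable def dpq (m : ℕ) (x : ℕ → ℝ) (p q : ℕ) : ℝ :=
  min (xExt m x ((q : ℤ) + 1) - x p) (x q - xExt m x ((p : ℤ) - 1))

/-- `Λ_{p,q,r}(x_0,…,x_m; φ)`. -/
noncomputable def Lam (m r : ℕ) (x : ℕ → ℝ) (φ : ℝ → ℝ) (p q : ℕ) : ℝ :=
  (∫ u in Set.Ioc (x q - x p) (dpq m x p q), u ^ ((p : ℤ) + r - q - 1) * φ u) /
    ((∏ i ∈ Finset.range p, (x q - x i)) * ∏ i ∈ Finset.Ioc q m, (x i - x p))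

/-- `Λ_r(x_0,…,x_m; φ) = max over admissible (p,q) of Λ_{p,q,r}`. -/
noncomputable def LamMax (m r : ℕ) (x : ℕ → ℝ) (φ : ℝ → ℝ) : ℝ :=
  sSup {v : ℝ | ∃ p q : ℕ, q ≤ m ∧ p + r + 1 ≤ q ∧ v = Lam m r x φ p q}

open Polynomial in
/-- `P` is the Hermite interpolation polynomial of the data `F` at the knots `l`. -/
def HermiteInterp (F : ℕ → ℝ → ℝ) (l : List ℝ) (P : ℝ[X]) : Prop :=
  P.degree < l.length ∧ ∀ z j, j < l.count z → (derivative^[j] P).eval z = F j z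

open Polynomial in
theorem pow_sub_dvd_of_iterate_derivative_eq_zero {R : ℝ[X]} {w : ℝ} {n : ℕ}
    (h : ∀ j < n, (derivative^[j] R).eval w = 0) : (X - C w) ^ n ∣ R := by
  rcases eq_or_ne R 0 with rfl | hR
  · exact dvd_zero _
  rcases n with _ | n
  · simp
  rw [← le_rootMultiplicity_iff hR, Nat.succ_le_iff,
    lt_rootMultiplicity_iff_isRoot_iterate_derivative hR]
  intro j hj
  exact h j (by omega)

open Polynomial in
theorem iterate_derivative_eq_zero_of_pow_sub_dvd {R : ℝ[X]} {w : ℝ} {n : ℕ}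
    (h : (X - C w) ^ n ∣ R) {j : ℕ} (hj : j < n) : (derivative^[j] R).eval w = 0 := by
  rcases eq_or_ne R 0 with rfl | hR
  · simp
  exact isRoot_iterate_derivative_of_lt_rootMultiplicity
    (hj.trans_le ((le_rootMultiplicity_iff hR).2 h))

namespace HermiteInterp

open Polynomial

variable {F : ℕ → ℝ → ℝ} {l l' : List ℝ} {P Q : ℝ[X]}

theorem perm (h : HermiteInterp F l P) (hl : l.Perm l') : HermiteInterp F l' P := by
  refine ⟨hl.length_eq ▸ h.1, fun z j hj => h.2 z j ?_⟩
  rwa [hl.count_eq]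

theorem pow_dvd_sub (hP : HermiteInterp F l P) (hQ : HermiteInterp F l' Q) {w : ℝ} {n : ℕ}
    (h1 : n ≤ l.count w) (h2 : n ≤ l'.count w) : (X - C w) ^ n ∣ P - Q := by
  refine pow_sub_dvd_of_iterate_derivative_eq_zero fun j hj => ?_
  rw [iterate_derivative_sub, eval_sub, hP.2 w j (by omega), hQ.2 w j (by omega), sub_self]

theorem unique (hP : HermiteInterp F l P) (hQ : HermiteInterp F l Q) : P = Q := by
  by_contra hne
  have hR : P - Q ≠ 0 := sub_ne_zero.2 hne
  have hle : (l : Multiset ℝ) ≤ (P - Q).roots := by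
    rw [Multiset.le_iff_count]
    intro w
    rw [count_roots, le_rootMultiplicity_iff hR, Multiset.coe_count]
    exact hP.pow_dvd_sub hQ le_rfl le_rfl
  have h1 : l.length ≤ (P - Q).roots.card := by simpa using Multiset.card_le_card hle
  have h2 : ((P - Q).roots.card : WithBot ℕ) ≤ (P - Q).degree := card_roots hR
  have h3 : (P - Q).degree < l.length :=
    (degree_sub_le P Q).trans_lt (max_lt hP.1 hQ.1)
  have : ((P - Q).roots.card : WithBot ℕ) < l.length := h2.trans_lt h3
  have : (P - Q).roots.card < l.length := by exact_mod_cast this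
  omega

theorem combine {M : List ℝ} {x z : ℝ} (hxz : x ≠ z) (h1 : HermiteInterp F (z :: M) P)
    (h2 : HermiteInterp F (x :: M) Q) :
    ∃ T : ℝ[X], HermiteInterp F (x :: z :: M) T ∧
      T.coeff (M.length + 1) = (P.coeff M.length - Q.coeff M.length) / (z - x) := by
  have hzx : z - x ≠ 0 := sub_ne_zero.2 hxz.symm
  have hC : C (z - x)⁻¹ * (C z - C x) = 1 := by
    rw [← C_sub, ← C_mul, inv_mul_cancel₀ hzx, C_1]
  have d1 : P.degree ≤ M.length := by
    have := h1.1
    rw [List.length_cons] at this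
    exact Order.le_of_lt_succ (by exact_mod_cast this)
  have d2 : Q.degree ≤ M.length := by
    have := h2.1
    rw [List.length_cons] at this
    exact Order.le_of_lt_succ (by exact_mod_cast this)
  refine ⟨C (z - x)⁻¹ * ((X - C x) * P - (X - C z) * Q), ⟨?_, ?_⟩, ?_⟩
  · have e1 : ((X - C x) * P).degree ≤ 1 + (M.length : WithBot ℕ) :=
      (degree_mul_le _ _).trans (add_le_add (degree_X_sub_C_le x) d1)
    have e2 : ((X - C z) * Q).degree ≤ 1 + (M.length : WithBot ℕ) :=
      (degree_mul_le _ _).trans (add_le_add (degree_X_sub_C_le z) d2)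
    have e3 : (C (z - x)⁻¹ * ((X - C x) * P - (X - C z) * Q)).degree ≤
        1 + (M.length : WithBot ℕ) := by
      rw [degree_C_mul (inv_ne_zero hzx)]
      exact (degree_sub_le _ _).trans (max_le e1 e2)
    refine e3.trans_lt ?_
    simp only [List.length_cons]
    norm_cast
    omega
  · intro w j hj
    by_cases hw : w = x
    · subst hw
      have hc : (w :: z :: M).count w = M.count w + 1 := by
        rw [List.count_cons_self, List.count_cons_of_ne (Ne.symm hxz)]
      rw [hc] at hj
      have hd : (X - C w) ^ (M.count w + 1) ∣
          C (z - w)⁻¹ * ((X - C w) * P - (X - C z) * Q) - Q := by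
        have hd' : (X - C w) ^ M.count w ∣ P - Q :=
          h1.pow_dvd_sub h2 (List.count_le_count_cons) (List.count_le_count_cons)
        have he : C (z - w)⁻¹ * ((X - C w) * P - (X - C z) * Q) - Q =
            ((X - C w) * (P - Q)) * C (z - w)⁻¹ := by
          linear_combination Q * hC
        rw [he, pow_succ']
        exact (mul_dvd_mul_left _ hd').mul_right _
      have := iterate_derivative_eq_zero_of_pow_sub_dvd hd hj
      rw [iterate_derivative_sub, eval_sub, sub_eq_zero] at this
      rw [this]
      exact h2.2 w j (by rw [List.count_cons_self]; exact hj)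
    · have hc : (x :: z :: M).count w = (z :: M).count w :=
        List.count_cons_of_ne (Ne.symm hw)
      rw [hc] at hj
      have hd : (X - C w) ^ ((z :: M).count w) ∣
          C (z - x)⁻¹ * ((X - C x) * P - (X - C z) * Q) - P := by
        have hd' : (X - C w) ^ M.count w ∣ P - Q :=
          h1.pow_dvd_sub h2 (List.count_le_count_cons) (List.count_le_count_cons)
        have he : C (z - x)⁻¹ * ((X - C x) * P - (X - C z) * Q) - P =
            ((X - C z) * (P - Q)) * C (z - x)⁻¹ := by
          linear_combination P * hC
        rw [he]
        refine Dvd.dvd.mul_right ?_ _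
        by_cases hwz : w = z
        · subst hwz
          rw [List.count_cons_self, pow_succ']
          exact mul_dvd_mul_left _ hd'
        · rw [List.count_cons_of_ne (Ne.symm hwz)]
          exact hd'.mul_left _
      have := iterate_derivative_eq_zero_of_pow_sub_dvd hd hj
      rw [iterate_derivative_sub, eval_sub, sub_eq_zero] at this
      rw [this]
      exact h1.2 w j hj
  · have c1 : P.coeff (M.length + 1) = 0 :=
      coeff_eq_zero_of_degree_lt (d1.trans_lt (by norm_cast; omega))
    have c2 : Q.coeff (M.length + 1) = 0 :=
      coeff_eq_zero_of_degree_lt (d2.trans_lt (by norm_cast; omega))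
    rw [coeff_C_mul, coeff_sub, sub_mul, sub_mul, coeff_sub, coeff_sub, coeff_X_mul,
      coeff_X_mul, coeff_C_mul, coeff_C_mul, c1, c2]
    field_simp
    ring

theorem exists_replicate (F : ℕ → ℝ → ℝ) (x : ℝ) (n : ℕ) :
    ∃ P : ℝ[X], HermiteInterp F (List.replicate (n + 1) x) P ∧
      P.coeff n = F n x / n.factorial := by
  induction n with
  | zero =>
    refine ⟨C (F 0 x), ⟨degree_C_le.trans_lt (by norm_num), ?_⟩, by simp⟩
    intro z j hj
    have hz : z = x := by
      by_contra h
      rw [List.count_eq_zero_of_not_mem (by simp [h])] at hj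
      omega
    subst hz
    have : j = 0 := by simpa using hj
    subst this
    simp
  | succ n ih =>
    obtain ⟨P, hP, -⟩ := ih
    have hdP : P.degree < (n + 1 : ℕ) := by simpa using hP.1
    have hc : P.coeff (n + 1) = 0 := coeff_eq_zero_of_degree_lt hdP
    have hmon : ((X - C x) ^ (n + 1) : ℝ[X]).Monic := (monic_X_sub_C x).pow _
    have hnd : ((X - C x) ^ (n + 1) : ℝ[X]).natDegree = n + 1 := by simp
    refine ⟨P + C (F (n + 1) x / (n + 1).factorial) * (X - C x) ^ (n + 1), ⟨?_, ?_⟩, ?_⟩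
    · refine (degree_add_le _ _).trans_lt (max_lt (hdP.trans ?_) ?_)
      · simp only [List.length_replicate]; norm_cast; omega
      · refine ((degree_mul_le _ _).trans (add_le_add_left degree_C_le _)).trans_lt ?_
        rw [zero_add, degree_eq_natDegree hmon.ne_zero, hnd]
        simp only [List.length_replicate]; norm_cast; omega
    · intro z j hj
      have hz : z = x := by
        by_contra h
        rw [List.count_eq_zero_of_not_mem (by simp [h])] at hj
        omega
      subst hz
      rw [List.count_replicate_self] at hj
      rw [iterate_map_add, iterate_derivative_C_mul, iterate_derivative_X_sub_pow]
      rcases Nat.lt_or_ge j (n + 1) with h | h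
      · have h0 : n + 1 - j ≠ 0 := by omega
        simp [h0, hP.2 z j (by rwa [List.count_replicate_self])]
      · have hj' : j = n + 1 := by omega
        subst hj'
        rw [iterate_derivative_eq_zero_of_degree_lt hdP, Nat.descFactorial_self]
        simp
        field_simp
    · rw [coeff_add, hc, coeff_C_mul]
      have : ((X - C x) ^ (n + 1) : ℝ[X]).coeff (n + 1) = 1 := by
        have := hmon.coeff_natDegree
        rwa [hnd] at this
      rw [this]; ring

theorem exists_coeff_eq_divDiff (F : ℕ → ℝ → ℝ) :
    ∀ l : List ℝ, l ≠ [] → ∃ P : ℝ[X], HermiteInterp F l P ∧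
      P.coeff (l.length - 1) = divDiff F l
  | [], h => absurd rfl h
  | [x], _ => by
    obtain ⟨P, hP, hc⟩ := exists_replicate F x 0
    exact ⟨P, hP, by simpa [divDiff] using hc⟩
  | x :: y :: l, _ => by
    by_cases h : ∀ z ∈ y :: l, z = x
    · have hl : x :: y :: l = List.replicate ((y :: l).length + 1) x := by
        rw [List.eq_replicate_iff]
        exact ⟨by simp, fun z hz => by
          rcases List.mem_cons.1 hz with rfl | hz
          · rfl
          · exact h z hz⟩
      obtain ⟨P, hP, hc⟩ := exists_replicate F x (y :: l).length
      rw [← hl] at hP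
      refine ⟨P, hP, ?_⟩
      rw [divDiff, dif_pos h]
      exact hc
    · have hex : ∃ z ∈ y :: l, z ≠ x := by push Not at h; exact h
      rw [divDiff, dif_neg h]
      generalize hi : (y :: l).findIdx _ = i
      have hil : i < (y :: l).length := by
        rw [← hi]
        exact List.findIdx_lt_length_of_exists (by simpa using hex)
      have hne : x ≠ (y :: l)[i] := by
        have := List.findIdx_getElem (w := hi ▸ hil)
        simp only [hi] at this
        intro hx
        simp [← hx] at this
      have hget : (y :: l).getD i 0 = (y :: l)[i] := by
        rw [List.getD_eq_getElem?_getD, List.getElem?_eq_getElem hil]; rfl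
      have hperm : ((y :: l)[i] :: (y :: l).eraseIdx i).Perm (y :: l) :=
        List.getElem_cons_eraseIdx_perm hil
      have hlen : ((y :: l).eraseIdx i).length + 1 = (y :: l).length := by
        simpa using hperm.length_eq
      obtain ⟨P, hP, hPc⟩ := exists_coeff_eq_divDiff F (y :: l) (by simp)
      obtain ⟨Q, hQ, hQc⟩ := exists_coeff_eq_divDiff F (x :: (y :: l).eraseIdx i) (by simp)
      obtain ⟨T, hT, hTc⟩ := combine hne (hP.perm hperm.symm) hQ
      refine ⟨T, hT.perm (hperm.cons x), ?_⟩
      rw [hget, ← hPc, ← hQc]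
      have e1 : (y :: l).length - 1 = ((y :: l).eraseIdx i).length := by omega
      have e2 : (x :: y :: l).length - 1 = ((y :: l).eraseIdx i).length + 1 := by
        rw [hlen]; simp
      rw [e1, e2, hTc]
      simp
termination_by l => l.length
decreasing_by
  · simp
  · rw [List.length_cons, hlen]; simp

theorem coeff_eq_divDiff (hP : HermiteInterp F l P) (hl : l ≠ []) :
    P.coeff (l.length - 1) = divDiff F l := by
  obtain ⟨Q, hQ, hc⟩ := exists_coeff_eq_divDiff F l hl
  rw [hP.unique hQ, hc]

end HermiteInterp

theorem divDiff_eq_of_perm_cons_cons (F : ℕ → ℝ → ℝ) {l M : List ℝ} {x z : ℝ} (hxz : x ≠ z)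
    (hl : l.Perm (x :: z :: M)) :
    divDiff F l = (divDiff F (z :: M) - divDiff F (x :: M)) / (z - x) := by
  obtain ⟨P, hP, hPc⟩ := HermiteInterp.exists_coeff_eq_divDiff F (z :: M) (by simp)
  obtain ⟨Q, hQ, hQc⟩ := HermiteInterp.exists_coeff_eq_divDiff F (x :: M) (by simp)
  obtain ⟨T, hT, hTc⟩ := HermiteInterp.combine hxz hP hQ
  have hne : l ≠ [] := by rintro rfl; simpa using hl.length_eq
  rw [← (hT.perm hl.symm).coeff_eq_divDiff hne, hl.length_eq, ← hPc, ← hQc]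
  simpa using hTc

theorem divDiff_congr_perm (F : ℕ → ℝ → ℝ) {l l' : List ℝ} (h : l.Perm l') (hl : l ≠ []) :
    divDiff F l = divDiff F l' := by
  obtain ⟨P, hP, hPc⟩ := HermiteInterp.exists_coeff_eq_divDiff F l hl
  have hl' : l' ≠ [] := by rintro rfl; exact hl (List.perm_nil.1 h)
  rw [← hPc, ← (hP.perm h).coeff_eq_divDiff hl', h.length_eq]

/-- Recursion for divided differences which omits the first and the last knot. -/
theorem divDiff_ofFn_succ (F : ℕ → ℝ → ℝ) (x : ℕ → ℝ) (m : ℕ) (hx : x 0 ≠ x (m + 1)) :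
    divDiff F (List.ofFn fun i : Fin (m + 1 + 1) => x i) =
      (divDiff F (List.ofFn fun i : Fin (m + 1) => x (i + 1)) -
        divDiff F (List.ofFn fun i : Fin (m + 1) => x i)) / (x (m + 1) - x 0) := by
  have hA : (List.ofFn fun i : Fin (m + 1) => x (i + 1)).Perm
      (x (m + 1) :: List.ofFn fun i : Fin m => x (i + 1)) := by
    rw [List.ofFn_succ']
    simp [List.concat_eq_append]
  have hB : (List.ofFn fun i : Fin (m + 1) => x i) =
      (x 0 :: List.ofFn fun i : Fin m => x (i + 1)) := by
    simp [List.ofFn_succ]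
  have hl : (List.ofFn fun i : Fin (m + 1 + 1) => x i).Perm
      (x 0 :: x (m + 1) :: List.ofFn fun i : Fin m => x (i + 1)) := by
    rw [List.ofFn_succ]
    refine List.Perm.cons _ ?_
    simpa using hA
  rw [divDiff_eq_of_perm_cons_cons F hx hl, hB,
    divDiff_congr_perm F hA (by simp [List.ofFn_succ])]

open Polynomial in
theorem divDiff_sub_polynomial (F : ℕ → ℝ → ℝ) (P : ℝ[X]) {l : List ℝ} (hl : l ≠ [])
    (hP : P.degree < (l.length - 1 : ℕ)) :
    divDiff (fun j t => F j t - (derivative^[j] P).eval t) l = divDiff F l := by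
  obtain ⟨Q, hQ, hQc⟩ := HermiteInterp.exists_coeff_eq_divDiff F l hl
  have h : HermiteInterp (fun j t => F j t - (derivative^[j] P).eval t) l (Q - P) := by
    refine ⟨(degree_sub_le _ _).trans_lt (max_lt hQ.1 (hP.trans_le ?_)), fun z j hj => ?_⟩
    · exact_mod_cast Nat.sub_le _ _
    · rw [iterate_derivative_sub, eval_sub, hQ.2 z j hj]
  rw [← h.coeff_eq_divDiff hl, ← hQc, coeff_sub, coeff_eq_zero_of_degree_lt hP, sub_zero]

/-- `F` lists the derivatives, up to order `r`, of the function `F 0` on `[a, b]`. -/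
def IsDerivData (r : ℕ) (F : ℕ → ℝ → ℝ) (a b : ℝ) : Prop :=
  ∀ j < r, ∀ t ∈ Set.Icc a b, HasDerivWithinAt (F j) (F (j + 1) t) (Set.Icc a b) t

theorem IsDerivData.mono {r : ℕ} {F : ℕ → ℝ → ℝ} {a b a' b' : ℝ} (h : IsDerivData r F a b)
    (ha : a ≤ a') (hb : b' ≤ b) : IsDerivData r F a' b' := fun j hj t ht =>
  (h j hj t ⟨ha.trans ht.1, ht.2.trans hb⟩).mono (Set.Icc_subset_Icc ha hb)

open Polynomial in
theorem IsDerivData.sub_polynomial {r : ℕ} {F : ℕ → ℝ → ℝ} {a b : ℝ} (h : IsDerivData r F a b)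
    (P : ℝ[X]) : IsDerivData r (fun j t => F j t - (derivative^[j] P).eval t) a b := by
  intro j hj t ht
  have := (derivative^[j] P).hasDerivAt t
  have e : derivative (derivative^[j] P) = derivative^[j + 1] P :=
    (Function.iterate_succ_apply' _ _ _).symm
  rw [e] at this
  exact (h j hj t ht).sub this.hasDerivWithinAt

/-- Rolle's theorem for a function with zeros counted with multiplicities. -/
theorem exists_iterate_deriv_eq_zero (r : ℕ) : ∀ (G : ℕ → ℝ → ℝ) (a b : ℝ) (x : ℕ → ℝ),
    (∀ i j, i ≤ j → j ≤ r → x i ≤ x j) → (∀ i ≤ r, x i ∈ Set.Icc a b) → IsDerivData r G a b →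
    (∀ i j, i ≤ j → j ≤ r → x i = x j → G (j - i) (x i) = 0) →
    ∃ θ ∈ Set.Icc a b, G r θ = 0 := by
  induction r with
  | zero =>
    intro G a b x _ hx _ h
    exact ⟨x 0, hx 0 le_rfl, h 0 0 le_rfl le_rfl rfl⟩
  | succ r ih =>
    intro G a b x hmono hx hG h
    have hy : ∀ i, ∃ y, i ≤ r → x i ≤ y ∧ y ≤ x (i + 1) ∧ G 1 y = 0 ∧
        (y = x i → x i = x (i + 1)) ∧ (y = x (i + 1) → x i = x (i + 1)) := by
      intro i
      by_cases hi : i ≤ r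
      swap
      · exact ⟨0, fun h => absurd h hi⟩
      rcases (hmono i (i + 1) (by omega) (by omega)).eq_or_lt with he | hlt
      · refine ⟨x i, fun _ => ⟨le_rfl, he.le, ?_, fun _ => he, fun _ => he⟩⟩
        simpa using h i (i + 1) (by omega) (by omega) he
      · have h0 : ∀ k ≤ r + 1, G 0 (x k) = 0 := fun k hk => by
          simpa using h k k le_rfl hk rfl
        have hsub : Set.Icc (x i) (x (i + 1)) ⊆ Set.Icc a b :=
          Set.Icc_subset_Icc (hx i (by omega)).1 (hx (i + 1) (by omega)).2
        obtain ⟨y, hy, hy0⟩ := exists_hasDerivAt_eq_zero (f := G 0) (f' := G 1) hlt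
          (fun t ht => ((hG 0 (by omega) t (hsub ht)).mono hsub).continuousWithinAt)
          (by rw [h0 i (by omega), h0 (i + 1) (by omega)])
          (fun t ht => (hG 0 (by omega) t (hsub ⟨ht.1.le, ht.2.le⟩)).hasDerivAt
            (Icc_mem_nhds ((hx i (by omega)).1.trans_lt ht.1)
              (ht.2.trans_le (hx (i + 1) (by omega)).2)))
        exact ⟨y, fun _ => ⟨hy.1.le, hy.2.le, hy0, fun h => absurd h hy.1.ne',
          fun h => absurd h hy.2.ne⟩⟩
    choose y hy using hy
    have hxy : ∀ i j, i < j → j ≤ r → y i ≤ y j := fun i j hij hj =>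
      (hy i (by omega)).2.1.trans ((hmono (i + 1) j hij (by omega)).trans (hy j hj).1)
    refine ih (fun j => G (j + 1)) a b y ?_ ?_ ?_ ?_
    · intro i j hij hj
      rcases hij.eq_or_lt with rfl | hij
      · rfl
      · exact hxy i j hij hj
    · exact fun i hi => ⟨(hx i (by omega)).1.trans (hy i hi).1,
        (hy i hi).2.1.trans (hx (i + 1) (by omega)).2⟩
    · exact fun j hj => hG (j + 1) (by omega)
    · intro i j hij hj he
      rcases hij.eq_or_lt with rfl | hij
      · simpa using (hy i hj).2.2.1
      · obtain ⟨-, b1, -, -, d1⟩ := hy i (by omega)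
        obtain ⟨a2, -, -, c2, -⟩ := hy j hj
        have h1 : x (i + 1) ≤ x j := hmono (i + 1) j hij (by omega)
        have e1 : x i = x (i + 1) := d1 (by linarith)
        have e2 : x j = x (j + 1) := c2 (by linarith)
        have e3 : x (i + 1) = x j := by linarith
        have e4 : y i = x i := by linarith
        have := h i (j + 1) (by omega) (by omega) (by linarith)
        rw [show j + 1 - i = j - i + 1 by omega] at this
        show G (j - i + 1) (y i) = 0
        rw [e4, this]

theorem lt_count_ofFn {x : ℕ → ℝ} {n i j : ℕ} (hx : ∀ i j, i ≤ j → j ≤ n → x i ≤ x j)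
    (hij : i ≤ j) (hj : j ≤ n) (he : x i = x j) :
    j - i < (List.ofFn fun k : Fin (n + 1) => x k).count (x i) := by
  rw [← Nat.succ_le_iff, ← List.replicate_sublist_iff]
  have h1 : (List.ofFn fun k : Fin (n + 1) => x k) = (List.range' 0 (n + 1)).map x := by
    rw [← List.range_eq_range', List.ofFn_eq_map, ← List.map_coe_finRange_eq_range,
      List.map_map]
    rfl
  have h2 : List.replicate (j - i).succ (x i) = (List.range' i (j - i + 1)).map x := by
    symm
    rw [List.eq_replicate_iff]
    refine ⟨by simp, fun z hz => ?_⟩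
    obtain ⟨k, hk, rfl⟩ := List.mem_map.1 hz
    rw [List.mem_range'_1] at hk
    exact le_antisymm (he ▸ hx k j (by omega) hj) (hx i k hk.1 (by omega))
  have h3 : List.range' 0 (n + 1) =
      List.range' 0 i ++ List.range' i (j - i + 1) ++ List.range' (j + 1) (n - j) := by
    have e1 := List.range'_append_1 (s := 0) (m := i) (n := j - i + 1)
    have e2 := List.range'_append_1 (s := 0) (m := j + 1) (n := n - j)
    simp only [zero_add] at e1 e2
    rw [e1, show i + (j - i + 1) = j + 1 by omega, e2, show j + 1 + (n - j) = n + 1 by omega]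
  rw [h1, h2, h3]
  refine List.Sublist.map x ?_
  exact (List.sublist_append_right _ _).trans (List.sublist_append_left _ _)

open Polynomial in
theorem abs_divDiff_le {r : ℕ} {F : ℕ → ℝ → ℝ} {a b M : ℝ} {x : ℕ → ℝ}
    (hx : ∀ i j, i ≤ j → j ≤ r → x i ≤ x j) (hab : ∀ i ≤ r, x i ∈ Set.Icc a b)
    (hF : IsDerivData r F a b) (hM : ∀ t ∈ Set.Icc a b, |F r t| ≤ M) :
    |divDiff F (List.ofFn fun i : Fin (r + 1) => x i)| ≤ M := by
  obtain ⟨P, hP, hc⟩ := HermiteInterp.exists_coeff_eq_divDiff F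
    (List.ofFn fun i : Fin (r + 1) => x i) (by simp [List.ofFn_succ])
  have hd : P.degree < (r + 1 : ℕ) := by simpa using hP.1
  have hnd : P.natDegree ≤ r := by
    rcases eq_or_ne P 0 with rfl | h0
    · simp
    · exact Nat.lt_succ_iff.1 ((natDegree_lt_iff_degree_lt h0).2 hd)
  obtain ⟨θ, hθ, h0⟩ := exists_iterate_deriv_eq_zero r _ a b x hx hab (hF.sub_polynomial P)
    (fun i j hij hj he => by
      have := hP.2 (x i) (j - i) (lt_count_ofFn hx hij hj he)
      simp only [this, sub_self])
  have hPr : derivative^[r] P = C ((r.factorial : ℝ) * P.coeff r) := by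
    have h1 : (derivative^[r] P).natDegree = 0 :=
      Nat.le_zero.1 ((natDegree_iterate_derivative P r).trans (by omega))
    rw [eq_C_of_natDegree_eq_zero h1, coeff_iterate_derivative]
    simp [Nat.descFactorial_self]
  rw [hPr, eval_C, sub_eq_zero] at h0
  have hc' : P.coeff r = divDiff F (List.ofFn fun i : Fin (r + 1) => x i) := by simpa using hc
  rw [← hc']
  have h1 : (1 : ℝ) ≤ r.factorial := by exact_mod_cast Nat.one_le_iff_ne_zero.2 r.factorial_ne_zero
  calc |P.coeff r| ≤ r.factorial * |P.coeff r| := le_mul_of_one_le_left (abs_nonneg _) h1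
    _ = |F r θ| := by rw [h0, abs_mul, Nat.abs_cast]
    _ ≤ M := hM θ hθ

/-- The mixed difference of `g` with the steps in `l`. -/
def mixedDiff (l : List ℝ) (g : ℝ → ℝ) : ℝ → ℝ := l.foldr fwdDiff g

theorem mixedDiff_cons (u : ℝ) (l : List ℝ) (g : ℝ → ℝ) (x : ℝ) :
    mixedDiff (u :: l) g x = mixedDiff l g (x + u) - mixedDiff l g x := rfl

theorem fwdDiff_left_comm (u v : ℝ) (g : ℝ → ℝ) :
    fwdDiff u (fwdDiff v g) = fwdDiff v (fwdDiff u g) := by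
  funext x
  simp only [fwdDiff]
  rw [add_right_comm]
  ring

theorem mixedDiff_perm {l l' : List ℝ} (h : l.Perm l') (g : ℝ → ℝ) :
    mixedDiff l g = mixedDiff l' g := by
  have : LeftCommutative (fwdDiff : ℝ → (ℝ → ℝ) → ℝ → ℝ) := ⟨fwdDiff_left_comm⟩
  exact h.foldr_eq g

theorem mixedDiff_replicate (n : ℕ) (u : ℝ) (g : ℝ → ℝ) :
    mixedDiff (List.replicate n u) g = (fwdDiff u)^[n] g := by
  induction n with
  | zero => rfl
  | succ n ih =>
    rw [List.replicate_succ, Function.iterate_succ_apply', ← ih]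
    rfl

theorem mixedDiff_eq_zero {l : List ℝ} (h : (0 : ℝ) ∈ l) (g : ℝ → ℝ) (x : ℝ) :
    mixedDiff l g x = 0 := by
  obtain ⟨l', hl'⟩ : ∃ l', l.Perm (0 :: l') := ⟨_, List.perm_cons_erase h⟩
  rw [mixedDiff_perm hl', mixedDiff_cons, add_zero, sub_self]

theorem abs_mixedDiff_le_of_bounded {g : ℝ → ℝ} {a b M : ℝ} (hM : ∀ t ∈ Set.Icc a b, |g t| ≤ M) :
    ∀ (l : List ℝ) (x : ℝ), (∀ u ∈ l, 0 ≤ u) → a ≤ x → x + l.sum ≤ b →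
      |mixedDiff l g x| ≤ 2 ^ l.length * M
  | [], x, _, ha, hb => by
    simpa [mixedDiff] using hM x ⟨ha, by simpa using hb⟩
  | u :: l, x, hl, ha, hb => by
    have hu : 0 ≤ u := hl u (by simp)
    have hl' : ∀ v ∈ l, 0 ≤ v := fun v hv => hl v (by simp [hv])
    rw [List.sum_cons] at hb
    have h1 := abs_mixedDiff_le_of_bounded hM l (x + u) hl' (by linarith) (by linarith)
    have h2 := abs_mixedDiff_le_of_bounded hM l x hl' ha (by linarith)
    rw [mixedDiff_cons, List.length_cons, pow_succ]
    have := abs_sub (mixedDiff l g (x + u)) (mixedDiff l g x)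
    linarith

theorem fwdDiff_iter_neg_step (k : ℕ) (w : ℝ) (g : ℝ → ℝ) (y : ℝ) :
    (fwdDiff w)^[k] g y = (-1) ^ k * (fwdDiff (-w))^[k] g (y + k * w) := by
  induction k generalizing y with
  | zero => simp
  | succ k ih =>
    rw [Function.iterate_succ_apply', Function.iterate_succ_apply']
    unfold fwdDiff at *
    rw [ih, ih, show y + w + k * w = y + ((k + 1 : ℕ) : ℝ) * w by push_cast; ring,
      show y + ((k + 1 : ℕ) : ℝ) * w + -w = y + k * w by push_cast; ring]
    ring

theorem abs_fwdDiff_iter_le {g : ℝ → ℝ} {a b B : ℝ} {k : ℕ} (hk : k ≠ 0) (hB : 0 ≤ B)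
    (h : ∀ u > 0, ∀ t, a ≤ t → t + k * u ≤ b → |(fwdDiff u)^[k] g t| ≤ B) {w y : ℝ}
    (hy : y ∈ Set.Icc a b) (hyw : y + k * w ∈ Set.Icc a b) : |(fwdDiff w)^[k] g y| ≤ B := by
  rcases lt_trichotomy w 0 with hw | rfl | hw
  · rw [fwdDiff_iter_neg_step, abs_mul, abs_pow, abs_neg, abs_one, one_pow, one_mul]
    refine h (-w) (by linarith) _ hyw.1 ?_
    have : y + k * w + k * -w = y := by ring
    rw [this]; exact hy.2
  · rw [← mixedDiff_replicate, mixedDiff_eq_zero (by simp [hk]), abs_zero]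
    exact hB
  · exact h w hw y hy.1 hyw.2

theorem sum_alternating_eq_fwdDiff_iter (k : ℕ) (g : ℝ → ℝ) (y w : ℝ) :
    ∑ i ∈ Finset.range (k + 1), (-1 : ℝ) ^ i * (k.choose i) * g (y + i * w) =
      (-1) ^ k * (fwdDiff w)^[k] g y := by
  rw [fwdDiff_iter_eq_sum_shift, Finset.mul_sum]
  refine Finset.sum_congr rfl fun i hi => ?_
  have hik : i ≤ k := Nat.lt_succ_iff.1 (Finset.mem_range.1 hi)
  have h1 : (-1 : ℝ) ^ i = (-1) ^ k * (-1) ^ (k - i) := by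
    rw [← pow_add, show k + (k - i) = i + 2 * (k - i) by omega, pow_add, pow_mul]
    norm_num
  simp only [zsmul_eq_mul, nsmul_eq_mul]
  push_cast
  rw [h1]
  ring

theorem abs_sum_mixedDiff_le {g : ℝ → ℝ} {a b B d : ℝ} {k : ℕ} (hk : k ≠ 0) (hB : 0 ≤ B)
    (h : ∀ u > 0, ∀ t, a ≤ t → t + k * u ≤ b → |(fwdDiff u)^[k] g t| ≤ B) :
    ∀ (L : List (ℝ × ℝ)) (y w : ℝ), (∀ p ∈ L, |p.1| ≤ d ∧ |p.1 + k * p.2| ≤ d) →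
      y ∈ Set.Icc (a + L.length * d) (b - L.length * d) →
      y + k * w ∈ Set.Icc (a + L.length * d) (b - L.length * d) →
      |∑ i ∈ Finset.range (k + 1), (-1 : ℝ) ^ i * (k.choose i) *
        mixedDiff (L.map fun p => p.1 + i * p.2) g (y + i * w)| ≤ 2 ^ L.length * B
  | [], y, w, _, hy, hyw => by
    have := abs_fwdDiff_iter_le hk hB h (w := w) (y := y) (by simpa using hy) (by simpa using hyw)
    simp only [List.map_nil, mixedDiff, List.foldr_nil]
    rw [sum_alternating_eq_fwdDiff_iter, abs_mul, abs_pow, abs_neg, abs_one, one_pow]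
    simpa using this
  | p :: L, y, w, hL, hy, hyw => by
    have hp := hL p (by simp)
    have hL' : ∀ q ∈ L, |q.1| ≤ d ∧ |q.1 + k * q.2| ≤ d := fun q hq => hL q (by simp [hq])
    rw [List.length_cons] at hy hyw
    push_cast at hy hyw
    obtain ⟨hy1, hy2⟩ := hy
    obtain ⟨hw1, hw2⟩ := hyw
    obtain ⟨hp1, hp2⟩ := hp
    rw [abs_le] at hp1 hp2
    have h1 := abs_sum_mixedDiff_le hk hB h L (y + p.1) (w + p.2) hL'
      ⟨by linarith, by linarith⟩ ⟨by linarith, by linarith⟩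
    have h2 := abs_sum_mixedDiff_le hk hB h L y w hL'
      ⟨by linarith, by linarith⟩ ⟨by linarith, by linarith⟩
    have e : ∑ i ∈ Finset.range (k + 1), (-1 : ℝ) ^ i * (k.choose i) *
          mixedDiff ((p :: L).map fun p => p.1 + i * p.2) g (y + i * w) =
        (∑ i ∈ Finset.range (k + 1), (-1 : ℝ) ^ i * (k.choose i) *
          mixedDiff (L.map fun p => p.1 + i * p.2) g (y + p.1 + i * (w + p.2))) -
        ∑ i ∈ Finset.range (k + 1), (-1 : ℝ) ^ i * (k.choose i) *
          mixedDiff (L.map fun p => p.1 + i * p.2) g (y + i * w) := by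
      rw [← Finset.sum_sub_distrib]
      refine Finset.sum_congr rfl fun i _ => ?_
      rw [List.map_cons, mixedDiff_cons,
        show y + i * w + (p.1 + i * p.2) = y + p.1 + i * (w + p.2) by ring]
      ring
    rw [e, List.length_cons, pow_succ]
    refine (abs_sub _ _).trans ?_
    linarith

/-- The steps of the differences in Kemperman's identity, as affine functions. -/
noncomputable def kempermanSteps : List ℝ → List (ℝ × ℝ)
  | [] => []
  | u :: l => (u, -u / (l.length + 1)) :: kempermanSteps l

theorem length_kempermanSteps : ∀ l : List ℝ, (kempermanSteps l).length = l.length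
  | [] => rfl
  | _ :: l => by simp [kempermanSteps, length_kempermanSteps l]

theorem map_fst_kempermanSteps : ∀ l : List ℝ, (kempermanSteps l).map Prod.fst = l
  | [] => rfl
  | _ :: l => by simp [kempermanSteps, map_fst_kempermanSteps l]

theorem zero_mem_map_kempermanSteps (i : ℕ) (hi : i ≠ 0) : ∀ l : List ℝ, i ≤ l.length →
    (0 : ℝ) ∈ (kempermanSteps l).map (fun p : ℝ × ℝ => p.1 + (i : ℝ) * p.2)
  | [], h => absurd (Nat.le_zero.1 h) hi
  | u :: l, h => by
    rw [kempermanSteps, List.map_cons, List.mem_cons]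
    rcases Nat.lt_or_ge l.length i with h' | h'
    · left
      have : i = l.length + 1 := by rw [List.length_cons] at h; omega
      subst this
      push_cast
      field_simp
      ring
    · exact Or.inr (zero_mem_map_kempermanSteps i hi l h')

theorem kempermanSteps_bound {d : ℝ} {k : ℕ} : ∀ l : List ℝ, l.length ≤ k →
    (∀ u ∈ l, 0 ≤ u ∧ u ≤ d) →
    ∀ p ∈ kempermanSteps l, |p.1| ≤ k * d ∧ |p.1 + k * p.2| ≤ k * d
  | [], _, _ => by simp [kempermanSteps]
  | u :: l, hk, hl => by
    intro p hp
    rw [kempermanSteps, List.mem_cons] at hp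
    rw [List.length_cons] at hk
    rcases hp with rfl | hp
    · obtain ⟨h0, h1⟩ := hl u (by simp)
      have hk1 : ((l.length : ℝ) + 1) ≤ k := by exact_mod_cast hk
      have hl0 : (0 : ℝ) ≤ l.length := Nat.cast_nonneg _
      have hk2 : (1 : ℝ) ≤ k := by linarith
      have hkd : u ≤ k * d := by nlinarith
      refine ⟨by rw [abs_of_nonneg h0]; exact hkd, ?_⟩
      have h2 : 0 ≤ u / (l.length + 1) := by positivity
      have h3 : u / (l.length + 1) ≤ d := (div_le_self h0 (by linarith)).trans h1
      have e : u + k * (-u / (l.length + 1)) = u - k * (u / (l.length + 1)) := by ring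
      rw [e, abs_le]
      constructor
      · have : k * (u / (l.length + 1)) ≤ k * d := by gcongr
        linarith
      · have : 0 ≤ k * (u / (l.length + 1)) := by positivity
        linarith
    · exact kempermanSteps_bound l (by omega) (fun u hu => hl u (by simp [hu])) p hp

/-- Mixed differences are controlled by differences with equal steps. -/
theorem abs_mixedDiff_le {g : ℝ → ℝ} {a b B d : ℝ} {k : ℕ} (hk : k ≠ 0) (hB : 0 ≤ B)
    (h : ∀ u > 0, ∀ t, a ≤ t → t + k * u ≤ b → |(fwdDiff u)^[k] g t| ≤ B)
    {l : List ℝ} (hlk : l.length = k) (hl : ∀ u ∈ l, 0 ≤ u ∧ u ≤ d) {x : ℝ}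
    (hx : x ∈ Set.Icc (a + k * (k * d)) (b - k * (k * d))) :
    |mixedDiff l g x| ≤ 2 ^ k * B := by
  have hlen : (kempermanSteps l).length = k := by rw [length_kempermanSteps, hlk]
  have := abs_sum_mixedDiff_le (d := k * d) hk hB h (kempermanSteps l) x 0
    (kempermanSteps_bound l hlk.le hl) (by rw [hlen]; exact hx) (by rw [hlen]; simpa using hx)
  rw [hlen, Finset.sum_eq_single 0] at this
  · simpa [map_fst_kempermanSteps] using this
  · intro i hi hi0
    rw [mixedDiff_eq_zero (zero_mem_map_kempermanSteps i hi0 l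
      (by rw [hlk]; exact Nat.lt_succ_iff.1 (Finset.mem_range.1 hi))), mul_zero]
  · simp

/-- Hyers–Ulam stability of the Cauchy equation on an interval. -/
theorem abs_sub_linear_le {B : ℝ → ℝ} {δ M ε : ℝ} (hδ : 0 < δ)
    (hM : ∀ u ∈ Set.Icc 0 δ, |B u| ≤ M)
    (h : ∀ u v, 0 ≤ u → 0 ≤ v → u + v ≤ δ → |B (u + v) - B u - B v| ≤ ε)
    {u : ℝ} (hu : u ∈ Set.Icc 0 δ) : |B u - u / δ * B δ| ≤ 3 * ε := by
  set D : ℝ → ℝ := fun u => B u - u / δ * B δ with hD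
  have hDδ : D δ = 0 := by simp [hD, hδ.ne']
  have hDadd : ∀ u v, 0 ≤ u → 0 ≤ v → u + v ≤ δ → |D (u + v) - D u - D v| ≤ ε := by
    intro u v h1 h2 h3
    have e : D (u + v) - D u - D v = B (u + v) - B u - B v := by simp only [hD]; ring
    rw [e]; exact h u v h1 h2 h3
  have hε : 0 ≤ ε := (abs_nonneg _).trans (h 0 0 le_rfl le_rfl (by linarith))
  have key : ∀ N : ℕ, ∀ u ∈ Set.Icc 0 δ, |D u| ≤ 3 * ε + 2 * M * (1 / 2) ^ N := by
    intro N
    induction N with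
    | zero =>
      rintro u ⟨hu0, hu1⟩
      have h1 := hM u ⟨hu0, hu1⟩
      have h2 := hM δ ⟨hδ.le, le_rfl⟩
      have h3 : |u / δ * B δ| ≤ M := by
        rw [abs_mul, abs_of_nonneg (by positivity)]
        have : u / δ ≤ 1 := (div_le_one hδ).2 hu1
        exact (mul_le_of_le_one_left (abs_nonneg _) this).trans h2
      have := abs_sub (B u) (u / δ * B δ)
      simp only [hD, pow_zero]
      linarith
    | succ N ih =>
      have small : ∀ u, 0 ≤ u → u ≤ δ / 2 → |D u| ≤ 2 * ε + 2 * M * (1 / 2) ^ (N + 1) := by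
        intro u h0 h1
        have h2 := ih (u + u) ⟨by linarith, by linarith⟩
        have h3 := hDadd u u h0 h0 (by linarith)
        rw [pow_succ]
        rw [abs_le] at *
        constructor <;> linarith
      rintro u ⟨hu0, hu1⟩
      rcases le_or_gt u (δ / 2) with h' | h'
      · have := small u hu0 h'
        linarith
      · have h2 := small (δ - u) (by linarith) (by linarith)
        have h3 := hDadd u (δ - u) hu0 (by linarith) (by linarith)
        rw [show u + (δ - u) = δ by ring, hDδ] at h3
        rw [abs_le] at *
        constructor <;> linarith
  have hlim : Filter.Tendsto (fun N : ℕ => 3 * ε + 2 * M * (1 / 2 : ℝ) ^ N) Filter.atTop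
      (nhds (3 * ε + 2 * M * 0)) :=
    ((tendsto_pow_atTop_nhds_zero_of_lt_one (by norm_num) (by norm_num)).const_mul _).const_add _
  rw [mul_zero, add_zero] at hlim
  exact ge_of_tendsto' hlim fun N => key N u hu

theorem mixedDiff_add_sub (u v : ℝ) (l : List ℝ) (g : ℝ → ℝ) (x : ℝ) :
    mixedDiff ((u + v) :: l) g x - mixedDiff (u :: l) g x - mixedDiff (v :: l) g x =
      mixedDiff (u :: v :: l) g x := by
  simp only [mixedDiff_cons]
  rw [add_assoc]
  ring

theorem abs_mixedDiff_cons_sub_le {g : ℝ → ℝ} {x δ M ε : ℝ} {n : ℕ} (hδ : 0 < δ)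
    (hM : ∀ l : List ℝ, l.length = n + 1 → (∀ u ∈ l, 0 ≤ u ∧ u ≤ δ) → |mixedDiff l g x| ≤ M)
    (hε : ∀ l : List ℝ, l.length = n + 2 → (∀ u ∈ l, 0 ≤ u ∧ u ≤ δ) → |mixedDiff l g x| ≤ ε)
    {l : List ℝ} (hln : l.length = n) (hl : ∀ u ∈ l, 0 ≤ u ∧ u ≤ δ) {u : ℝ}
    (hu : u ∈ Set.Icc 0 δ) :
    |mixedDiff (u :: l) g x - u / δ * mixedDiff (δ :: l) g x| ≤ 3 * ε := by
  refine abs_sub_linear_le (B := fun u => mixedDiff (u :: l) g x) (M := M) hδ ?_ ?_ hu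
  · rintro u ⟨h0, h1⟩
    refine hM _ (by simp [hln]) ?_
    simp only [List.mem_cons, forall_eq_or_imp]
    exact ⟨⟨h0, h1⟩, hl⟩
  · intro u v hu hv huv
    rw [mixedDiff_add_sub]
    refine hε _ (by simp [hln]) ?_
    simp only [List.mem_cons, forall_eq_or_imp]
    exact ⟨⟨hu, by linarith⟩, ⟨hv, by linarith⟩, hl⟩

theorem abs_fwdDiff_iter_sub_scale_le {g : ℝ → ℝ} {x δ M ε : ℝ} {n : ℕ} (hδ : 0 < δ)
    (hM : ∀ l : List ℝ, l.length = n + 1 → (∀ u ∈ l, 0 ≤ u ∧ u ≤ δ) → |mixedDiff l g x| ≤ M)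
    (hε : ∀ l : List ℝ, l.length = n + 2 → (∀ u ∈ l, 0 ≤ u ∧ u ≤ δ) → |mixedDiff l g x| ≤ ε)
    {u : ℝ} (hu : u ∈ Set.Icc 0 δ) :
    |(fwdDiff u)^[n + 1] g x - (u / δ) ^ (n + 1) * (fwdDiff δ)^[n + 1] g x| ≤
      3 * (n + 1) * ε := by
  have hε0 : 0 ≤ ε := (abs_nonneg _).trans
    (hε (List.replicate (n + 2) 0) (by simp) (by simp [hδ.le]))
  have hq0 : 0 ≤ u / δ := div_nonneg hu.1 hδ.le
  have hq1 : u / δ ≤ 1 := (div_le_one hδ).2 hu.2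
  have key : ∀ i ≤ n + 1, |mixedDiff (List.replicate (n + 1) u) g x - (u / δ) ^ i *
      mixedDiff (List.replicate i δ ++ List.replicate (n + 1 - i) u) g x| ≤ 3 * i * ε := by
    intro i
    induction i with
    | zero => simp
    | succ i ih =>
      intro hi
      have h1 := ih (by omega)
      set l := List.replicate i δ ++ List.replicate (n - i) u with hl
      have e1 : mixedDiff (List.replicate i δ ++ List.replicate (n + 1 - i) u) g x =
          mixedDiff (u :: l) g x := by
        rw [show n + 1 - i = (n - i) + 1 by omega, List.replicate_succ,
          mixedDiff_perm List.perm_middle]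
      have e2 : mixedDiff (List.replicate (i + 1) δ ++ List.replicate (n + 1 - (i + 1)) u) g x =
          mixedDiff (δ :: l) g x := by
        rw [show n + 1 - (i + 1) = n - i by omega, List.replicate_succ, List.cons_append]
      have h2 := abs_mixedDiff_cons_sub_le (l := l) hδ hM hε (by simp [hl]; omega)
        (by
          intro v hv
          rw [hl, List.mem_append, List.mem_replicate, List.mem_replicate] at hv
          rcases hv with ⟨_, rfl⟩ | ⟨_, rfl⟩
          · exact ⟨hδ.le, le_rfl⟩
          · exact hu) hu
      rw [e1] at h1
      rw [e2]
      have h3 : |(u / δ) ^ i * (mixedDiff (u :: l) g x - u / δ * mixedDiff (δ :: l) g x)| ≤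
          3 * ε := by
        rw [abs_mul, abs_of_nonneg (by positivity)]
        exact (mul_le_of_le_one_left (abs_nonneg _) (pow_le_one₀ hq0 hq1)).trans h2
      have e3 : mixedDiff (List.replicate (n + 1) u) g x -
          (u / δ) ^ (i + 1) * mixedDiff (δ :: l) g x =
          (mixedDiff (List.replicate (n + 1) u) g x - (u / δ) ^ i * mixedDiff (u :: l) g x) +
          (u / δ) ^ i * (mixedDiff (u :: l) g x - u / δ * mixedDiff (δ :: l) g x) := by ring
      rw [e3]
      refine (abs_add_le _ _).trans ?_
      push_cast
      linarith
  have := key (n + 1) le_rfl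
  simpa [mixedDiff_replicate] using this

theorem exists_local_leading_coeff {g : ℝ → ℝ} {a b M B δ : ℝ} {n : ℕ} (hab : a < b)
    (hM : ∀ t ∈ Set.Icc a b, |g t| ≤ M) (hB : 0 ≤ B)
    (h : ∀ u > 0, ∀ t, a ≤ t → t + (n + 2 : ℕ) * u ≤ b → |(fwdDiff u)^[n + 2] g t| ≤ B)
    (hδ : 4 * (n + 2 : ℝ) ^ 2 * δ = b - a) :
    ∃ A : ℝ, ∀ u ∈ Set.Icc 0 δ, ∀ x ∈ Set.Icc ((a + b) / 2) ((a + b) / 2 + δ),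
      |(fwdDiff u)^[n + 1] g x - A * u ^ (n + 1)| ≤ (3 * (n + 1) + 1) * (2 ^ (n + 2) * B) := by
  have hδ0 : 0 < δ := by
    by_contra hc
    have : 4 * (n + 2 : ℝ) ^ 2 * δ ≤ 0 := mul_nonpos_of_nonneg_of_nonpos (by positivity) (by linarith)
    linarith
  have hn : (0 : ℝ) ≤ n := Nat.cast_nonneg n
  have hδ16 : (4 * n + 16) * δ ≤ b - a := by
    rw [← hδ]; gcongr; nlinarith
  set mid := (a + b) / 2 with hmid
  have hroom : ∀ x ∈ Set.Icc mid (mid + δ), x ∈ Set.Icc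
      (a + (n + 2 : ℕ) * ((n + 2 : ℕ) * δ)) (b - (n + 2 : ℕ) * ((n + 2 : ℕ) * δ)) := by
    rintro x ⟨h1, h2⟩
    have e : ((n + 2 : ℕ) : ℝ) * ((n + 2 : ℕ) * δ) = (b - a) / 4 := by
      rw [← hδ]; push_cast; ring
    have : 16 * δ ≤ b - a := by nlinarith
    rw [e]
    constructor <;> linarith
  have hε : ∀ x ∈ Set.Icc mid (mid + δ), ∀ l : List ℝ, l.length = n + 2 →
      (∀ u ∈ l, 0 ≤ u ∧ u ≤ δ) → |mixedDiff l g x| ≤ 2 ^ (n + 2) * B := fun x hx l hln hl =>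
    abs_mixedDiff_le (by omega) hB h hln hl (hroom x hx)
  have hMl : ∀ x ∈ Set.Icc mid (mid + δ), ∀ l : List ℝ, l.length = n + 1 →
      (∀ u ∈ l, 0 ≤ u ∧ u ≤ δ) → |mixedDiff l g x| ≤ 2 ^ (n + 1) * M := by
    rintro x ⟨h1, h2⟩ l hln hl
    have hs : l.sum ≤ (n + 1) * δ := by
      have := List.sum_le_card_nsmul l δ fun u hu => (hl u hu).2
      rw [hln, nsmul_eq_mul] at this
      exact_mod_cast this
    have := abs_mixedDiff_le_of_bounded hM l x (fun u hu => (hl u hu).1) (by linarith)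
      (by nlinarith)
    rwa [hln] at this
  set D := (fwdDiff δ)^[n + 1] g mid with hD
  refine ⟨D / δ ^ (n + 1), fun u hu x hx => ?_⟩
  have h1 := abs_fwdDiff_iter_sub_scale_le hδ0 (hMl x hx) (hε x hx) hu
  have h2 : |(fwdDiff δ)^[n + 1] g x - D| ≤ 2 ^ (n + 2) * B := by
    have := hε mid ⟨le_rfl, by linarith⟩ ((x - mid) :: List.replicate (n + 1) δ) (by simp) (by
      intro v hv
      rw [List.mem_cons, List.mem_replicate] at hv
      rcases hv with rfl | ⟨_, rfl⟩
      · exact ⟨by linarith [hx.1], by linarith [hx.2]⟩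
      · exact ⟨hδ0.le, le_rfl⟩)
    rw [mixedDiff_cons, mixedDiff_replicate] at this
    simpa [hD] using this
  have hq0 : 0 ≤ u / δ := div_nonneg hu.1 hδ0.le
  have hq1 : u / δ ≤ 1 := (div_le_one hδ0).2 hu.2
  have h3 : |(u / δ) ^ (n + 1) * ((fwdDiff δ)^[n + 1] g x - D)| ≤ 2 ^ (n + 2) * B := by
    rw [abs_mul, abs_of_nonneg (by positivity)]
    exact (mul_le_of_le_one_left (abs_nonneg _) (pow_le_one₀ hq0 hq1)).trans h2
  have e : (fwdDiff u)^[n + 1] g x - D / δ ^ (n + 1) * u ^ (n + 1) =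
      ((fwdDiff u)^[n + 1] g x - (u / δ) ^ (n + 1) * (fwdDiff δ)^[n + 1] g x) +
      (u / δ) ^ (n + 1) * ((fwdDiff δ)^[n + 1] g x - D) := by
    rw [div_pow]; ring
  rw [e]
  refine (abs_add_le _ _).trans ?_
  linarith

theorem abs_fwdDiff_iter_shift_sub_le {g : ℝ → ℝ} {a b B u : ℝ} {n : ℕ} (hu : 0 < u)
    (h : ∀ t, a ≤ t → t + (n + 1 : ℕ) * u ≤ b → |(fwdDiff u)^[n + 1] g t| ≤ B) (j : ℕ) {t : ℝ}
    (ht : a ≤ t) (htb : t + j * u + n * u ≤ b) :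
    |(fwdDiff u)^[n] g (t + j * u) - (fwdDiff u)^[n] g t| ≤ j * B := by
  induction j with
  | zero => simp
  | succ j ih =>
    push_cast at htb
    have hj : (0 : ℝ) ≤ j * u := by positivity
    have h1 := ih (by linarith)
    have h2 := h (t + j * u) (by linarith) (by push_cast; linarith)
    rw [Function.iterate_succ_apply', fwdDiff,
      show t + j * u + u = t + ((j + 1 : ℕ) : ℝ) * u by push_cast; ring] at h2
    have e : (fwdDiff u)^[n] g (t + ((j + 1 : ℕ) : ℝ) * u) - (fwdDiff u)^[n] g t =
      ((fwdDiff u)^[n] g (t + ((j + 1 : ℕ) : ℝ) * u) - (fwdDiff u)^[n] g (t + j * u)) +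
      ((fwdDiff u)^[n] g (t + j * u) - (fwdDiff u)^[n] g t) := by ring
    have e' : ((j + 1 : ℕ) : ℝ) * B = j * B + B := by push_cast; ring
    rw [e, e']
    refine (abs_add_le _ _).trans ?_
    linarith

theorem exists_leading_coeff_intermediate {g : ℝ → ℝ} {a b M B δ : ℝ} {n : ℕ} (hab : a < b)
    (hM : ∀ t ∈ Set.Icc a b, |g t| ≤ M) (hB : 0 ≤ B)
    (h : ∀ u > 0, ∀ t, a ≤ t → t + (n + 2 : ℕ) * u ≤ b → |(fwdDiff u)^[n + 2] g t| ≤ B)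
    (hδ : 4 * (n + 2 : ℝ) ^ 2 * δ = b - a) :
    ∃ A : ℝ, ∀ u ∈ Set.Icc (δ / 2) δ, ∀ t, a ≤ t → t + (n + 1 : ℕ) * u ≤ b →
      |(fwdDiff u)^[n + 1] g t - A * u ^ (n + 1)| ≤
        (4 * (n + 2) ^ 2 + 1 + (3 * (n + 1) + 1) * 2 ^ (n + 2)) * B := by
  have hδ0 : 0 < δ := by
    by_contra hc
    have : 4 * (n + 2 : ℝ) ^ 2 * δ ≤ 0 := mul_nonpos_of_nonneg_of_nonpos (by positivity) (by linarith)
    linarith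
  have hn : (0 : ℝ) ≤ n := Nat.cast_nonneg n
  have hδ16 : (4 * n + 16) * δ ≤ b - a := by
    rw [← hδ]; gcongr; nlinarith
  obtain ⟨A, hA⟩ := exists_local_leading_coeff hab hM hB h hδ
  refine ⟨A, fun u hu t hta htb => ?_⟩
  set mid := (a + b) / 2 with hmid
  have hu0 : 0 < u := by linarith [hu.1]
  push_cast at htb
  have hnu : (n + 1) * u ≤ (n + 1) * δ := by gcongr; exact hu.2
  suffices hs : ∃ j : ℕ, (j : ℝ) ≤ (b - a) / 2 / u + 1 ∧ ∃ x ∈ Set.Icc mid (mid + u),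
      |(fwdDiff u)^[n + 1] g x - (fwdDiff u)^[n + 1] g t| ≤ j * B by
    obtain ⟨j, hj, x, hx, hxt⟩ := hs
    have h1 := hA u ⟨hu0.le, hu.2⟩ x ⟨hx.1, by linarith [hx.2, hu.2]⟩
    have h2 : (b - a) / 2 / u ≤ 4 * (n + 2) ^ 2 := by
      rw [div_le_iff₀ hu0, ← hδ]
      have := mul_le_mul_of_nonneg_left hu.1 (by positivity : (0 : ℝ) ≤ 4 * (n + 2) ^ 2)
      linarith
    have h3 : j * B ≤ (4 * (n + 2) ^ 2 + 1) * B := by gcongr; linarith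
    have e : (fwdDiff u)^[n + 1] g t - A * u ^ (n + 1) =
      ((fwdDiff u)^[n + 1] g x - A * u ^ (n + 1)) -
        ((fwdDiff u)^[n + 1] g x - (fwdDiff u)^[n + 1] g t) := by ring
    rw [e]
    refine (abs_sub _ _).trans ?_
    linarith
  rcases le_total t mid with htm | htm
  · have h0 : 0 ≤ (mid - t) / u := div_nonneg (by linarith) hu0.le
    have h1 := Nat.le_ceil ((mid - t) / u)
    have h2 := (Nat.ceil_lt_add_one h0).le
    set j := ⌈(mid - t) / u⌉₊
    have h3 : (mid - t) / u ≤ (b - a) / 2 / u := by gcongr; linarith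
    have e : (mid - t) / u * u = mid - t := div_mul_cancel₀ _ hu0.ne'
    have h4 := mul_le_mul_of_nonneg_right h1 hu0.le
    have h5 := mul_le_mul_of_nonneg_right h2 hu0.le
    rw [add_mul, e] at h5
    rw [e] at h4
    refine ⟨j, by linarith, t + j * u, ⟨by linarith, by linarith⟩, ?_⟩
    exact abs_fwdDiff_iter_shift_sub_le hu0 (h u hu0) j hta (by push_cast; nlinarith [hu.2])
  · have h0 : 0 ≤ (t - mid) / u := div_nonneg (by linarith) hu0.le
    have h1 := Nat.floor_le h0
    have h2 := (Nat.lt_floor_add_one ((t - mid) / u)).le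
    set j := ⌊(t - mid) / u⌋₊
    have h3 : (t - mid) / u ≤ (b - a) / 2 / u := by
      gcongr
      have : 0 ≤ (n + 1) * u := by positivity
      linarith
    have e : (t - mid) / u * u = t - mid := div_mul_cancel₀ _ hu0.ne'
    have h4 := mul_le_mul_of_nonneg_right h1 hu0.le
    have h5 := mul_le_mul_of_nonneg_right h2 hu0.le
    rw [add_mul, e] at h5
    rw [e] at h4
    refine ⟨j, by linarith, t - j * u, ⟨by linarith, by linarith⟩, ?_⟩
    have := abs_fwdDiff_iter_shift_sub_le hu0 (h u hu0) j (t := t - j * u) (by linarith)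
      (by push_cast; linarith)
    rwa [sub_add_cancel, abs_sub_comm] at this

theorem fwdDiff_two_mul_iter (v : ℝ) (n : ℕ) (g : ℝ → ℝ) :
    (fwdDiff (2 * v))^[n] g = (fun f x => f x + f (x + v))^[n] ((fwdDiff v)^[n] g) := by
  have hc : Function.Commute (fun (f : ℝ → ℝ) x => f x + f (x + v)) (fwdDiff v) := by
    intro f
    funext x
    simp only [fwdDiff]
    ring
  have e : fwdDiff (2 * v) = (fun (f : ℝ → ℝ) x => f x + f (x + v)) ∘ (fwdDiff v) := by
    funext f x
    simp only [fwdDiff, Function.comp]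
    rw [add_assoc, ← two_mul]
    ring
  rw [e, hc.comp_iterate]
  rfl

theorem abs_iter_add_shift_sub_le {v c E : ℝ} (n : ℕ) {F : ℝ → ℝ} {t : ℝ}
    (h : ∀ i ≤ n, |F (t + i * v) - c| ≤ E) :
    |(fun (f : ℝ → ℝ) x => f x + f (x + v))^[n] F t - 2 ^ n * c| ≤ 2 ^ n * E := by
  induction n generalizing t with
  | zero => simpa using h 0 le_rfl
  | succ n ih =>
    rw [Function.iterate_succ_apply']
    have h1 := ih (t := t) fun i hi => h i (by omega)
    have h2 := ih (t := t + v) fun i hi => by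
      have := h (i + 1) (by omega)
      rwa [show t + ((i + 1 : ℕ) : ℝ) * v = t + v + i * v by push_cast; ring] at this
    rw [abs_le] at *
    rw [pow_succ]
    constructor <;> linarith

theorem abs_fwdDiff_two_mul_iter_sub_le {g : ℝ → ℝ} {v c E : ℝ} {n : ℕ} {t : ℝ}
    (h : ∀ i ≤ n, |(fwdDiff v)^[n] g (t + i * v) - c| ≤ E) :
    |(fwdDiff (2 * v))^[n] g t - 2 ^ n * c| ≤ 2 ^ n * E := by
  rw [fwdDiff_two_mul_iter]
  exact abs_iter_add_shift_sub_le n h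

theorem abs_fwdDiff_iter_sub_le_of_large {g : ℝ → ℝ} {a b A E δ : ℝ} {n : ℕ} (hδ : 0 < δ)
    (hE : 0 ≤ E)
    (h : ∀ u ∈ Set.Icc (δ / 2) δ, ∀ t, a ≤ t → t + n * u ≤ b →
      |(fwdDiff u)^[n] g t - A * u ^ n| ≤ E) (N : ℕ) :
    ∀ u ∈ Set.Icc (δ / 2) (2 ^ N * δ), ∀ t, a ≤ t → t + n * u ≤ b →
      |(fwdDiff u)^[n] g t - A * u ^ n| ≤ 2 ^ (n * N) * E := by
  induction N with
  | zero => simpa using h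
  | succ N ih =>
    rintro u ⟨hu1, hu2⟩ t hta htb
    rcases le_or_gt u (2 ^ N * δ) with hu | hu
    · refine (ih u ⟨hu1, hu⟩ t hta htb).trans ?_
      gcongr
      · norm_num
      · omega
    · have hu0 : 0 < u := by linarith
      have h1 : (1 : ℝ) ≤ 2 ^ N := one_le_pow₀ (by norm_num)
      have h1' : δ ≤ 2 ^ N * δ := le_mul_of_one_le_left hδ.le h1
      have := abs_fwdDiff_two_mul_iter_sub_le (g := g) (v := u / 2) (c := A * (u / 2) ^ n)
        (E := 2 ^ (n * N) * E) (n := n) (t := t) (by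
          intro i hi
          have hi' : (i : ℝ) * (u / 2) ≤ n * (u / 2) := by gcongr
          have hi0 : (0 : ℝ) ≤ i * (u / 2) := by positivity
          refine ih (u / 2) ⟨by linarith, ?_⟩ _ (by linarith) (by linarith)
          rw [pow_succ] at hu2
          linarith)
      have e : 2 ^ n * (A * (u / 2) ^ n) = A * u ^ n := by
        rw [div_pow]; field_simp
      rw [e, show 2 * (u / 2) = u by ring] at this
      refine this.trans (le_of_eq ?_)
      rw [mul_add, mul_one, pow_add]
      ring

theorem abs_fwdDiff_iter_sub_le_of_small {g : ℝ → ℝ} {a b A B E u : ℝ} {n : ℕ} (hu : 0 < u)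
    (hB : 0 ≤ B)
    (h : ∀ t, a ≤ t → t + (n + 1 : ℕ) * u ≤ b → |(fwdDiff u)^[n + 1] g t| ≤ B)
    (hE : ∀ t, a ≤ t → t + n * (2 * u) ≤ b →
      |(fwdDiff (2 * u))^[n] g t - A * (2 * u) ^ n| ≤ 2 ^ n * E)
    (hab : 3 * n * u ≤ b - a) {t : ℝ} (hta : a ≤ t) (htb : t + n * u ≤ b) :
    |(fwdDiff u)^[n] g t - A * u ^ n| ≤ E + n * B := by
  suffices hs : ∃ t', a ≤ t' ∧ t' + n * (2 * u) ≤ b ∧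
      ∀ i ≤ n, |(fwdDiff u)^[n] g (t' + i * u) - (fwdDiff u)^[n] g t| ≤ n * B by
    obtain ⟨t', h1, h2, h3⟩ := hs
    have h4 := abs_fwdDiff_two_mul_iter_sub_le h3
    have h5 := hE t' h1 h2
    have h6 : |2 ^ n * ((fwdDiff u)^[n] g t - A * u ^ n)| ≤ 2 ^ n * (E + n * B) := by
      have e : 2 ^ n * ((fwdDiff u)^[n] g t - A * u ^ n) =
        ((fwdDiff (2 * u))^[n] g t' - A * (2 * u) ^ n) -
        ((fwdDiff (2 * u))^[n] g t' - 2 ^ n * (fwdDiff u)^[n] g t) := by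
        rw [mul_pow]; ring
      rw [e]
      refine (abs_sub _ _).trans ?_
      linarith
    rw [abs_mul, abs_of_pos (by positivity)] at h6
    exact le_of_mul_le_mul_left h6 (by positivity)
  rcases le_total (t + n * (2 * u)) b with h' | h'
  · refine ⟨t, hta, h', fun i hi => ?_⟩
    have hi' : (i : ℝ) ≤ n := by exact_mod_cast hi
    have hi2 : (i : ℝ) * u ≤ n * u := by gcongr
    refine (abs_fwdDiff_iter_shift_sub_le hu h i hta (by linarith)).trans ?_
    gcongr
  · refine ⟨t - n * u, by linarith, by linarith, fun i hi => ?_⟩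
    have hi' : (i : ℝ) ≤ n := by exact_mod_cast hi
    have hi0 : (0 : ℝ) ≤ i * u := by positivity
    have e : ((n - i : ℕ) : ℝ) = n - i := Nat.cast_sub hi
    have := abs_fwdDiff_iter_shift_sub_le hu h (n - i) (t := t - n * u + i * u) (by linarith)
      (by rw [e]; linarith)
    rw [e, show t - n * u + i * u + (n - i) * u = t by ring, abs_sub_comm] at this
    refine this.trans ?_
    gcongr
    linarith [(Nat.cast_nonneg i : (0 : ℝ) ≤ i)]

theorem integrableOn_Ioi_div_pow {F : ℝ → ℝ} {M c : ℝ} {n : ℕ} (hn : n ≠ 0) (hc : 0 < c)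
    (hF : Measurable F) (hM : ∀ v, |F v| ≤ M) :
    MeasureTheory.IntegrableOn (fun v => F v / v ^ (n + 1)) (Set.Ioi c) := by
  have h1 : MeasureTheory.IntegrableOn (fun v : ℝ => v ^ (-((n : ℝ) + 1))) (Set.Ioi c) := by
    refine integrableOn_Ioi_rpow_of_lt ?_ hc
    have : (0 : ℝ) < n := by exact_mod_cast Nat.pos_of_ne_zero hn
    linarith
  have h2 : MeasureTheory.IntegrableOn (fun v : ℝ => (v ^ (n + 1))⁻¹) (Set.Ioi c) := by
    refine h1.congr_fun (fun v hv => ?_) measurableSet_Ioi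
    have hv0 : 0 < v := hc.trans hv
    dsimp only
    rw [Real.rpow_neg hv0.le]
    exact_mod_cast rfl
  have h3 := MeasureTheory.Integrable.bdd_mul (c := M) h2 hF.aestronglyMeasurable
    (Filter.Eventually.of_forall fun v => by rw [Real.norm_eq_abs]; exact hM v)
  exact h3

/-- The Marchaud-type majorant `u ^ n * ∫ v > u, φ (min v h) / v ^ (n + 1)`, after rescaling. -/
noncomputable def tailMajorant (n : ℕ) (φ : ℝ → ℝ) (h u : ℝ) : ℝ :=
  ∫ s in Set.Ioi (1 : ℝ), φ (min (u * s) h) / s ^ (n + 1)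

section TailMajorant

variable {φ : ℝ → ℝ} {h : ℝ} {n : ℕ}

theorem measurable_comp_min (hφ : Monotone φ) : Measurable fun v => φ (min v h) :=
  hφ.measurable.comp (measurable_id.min measurable_const)

theorem abs_comp_min_le (hφ : Monotone φ) (hφ0 : ∀ t, 0 ≤ φ t) (v : ℝ) :
    |φ (min v h)| ≤ φ h := by
  rw [abs_of_nonneg (hφ0 _)]
  exact hφ (min_le_right _ _)

theorem integrableOn_Ioi_comp_min (hn : n ≠ 0) (hφ : Monotone φ) (hφ0 : ∀ t, 0 ≤ φ t) {c : ℝ}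
    (hc : 0 < c) :
    MeasureTheory.IntegrableOn (fun v => φ (min v h) / v ^ (n + 1)) (Set.Ioi c) :=
  integrableOn_Ioi_div_pow hn hc (measurable_comp_min hφ) (abs_comp_min_le hφ hφ0)

theorem tailMajorant_nonneg (hφ0 : ∀ t, 0 ≤ φ t) (u : ℝ) : 0 ≤ tailMajorant n φ h u := by
  refine MeasureTheory.setIntegral_nonneg measurableSet_Ioi fun s hs => ?_
  have : (0 : ℝ) < s := zero_lt_one.trans hs
  have := hφ0 (min (u * s) h)
  positivity

theorem monotone_tailMajorant (hn : n ≠ 0) (hφ : Monotone φ) (hφ0 : ∀ t, 0 ≤ φ t) :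
    Monotone (tailMajorant n φ h) := by
  have hint : ∀ u, MeasureTheory.IntegrableOn (fun s => φ (min (u * s) h) / s ^ (n + 1))
      (Set.Ioi (1 : ℝ)) := fun u =>
    integrableOn_Ioi_div_pow (F := fun s => φ (min (u * s) h)) hn zero_lt_one
      ((measurable_comp_min hφ).comp (measurable_const_mul u)) fun s => abs_comp_min_le hφ hφ0 _
  intro u v huv
  refine MeasureTheory.setIntegral_mono_on (hint u) (hint v) measurableSet_Ioi fun s hs => ?_
  have hs0 : (0 : ℝ) < s := zero_lt_one.trans hs
  have : φ (min (u * s) h) ≤ φ (min (v * s) h) := hφ (by gcongr)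
  gcongr

theorem tailMajorant_eq {u : ℝ} (hu : 0 < u) :
    tailMajorant n φ h u = u ^ n * ∫ v in Set.Ioi u, φ (min v h) / v ^ (n + 1) := by
  have := MeasureTheory.integral_comp_mul_left_Ioi (fun v => φ (min v h) / v ^ (n + 1)) 1 hu
  rw [mul_one, smul_eq_mul] at this
  have e : ∫ v in Set.Ioi u, φ (min v h) / v ^ (n + 1) =
      u * ∫ s in Set.Ioi (1 : ℝ), φ (min (u * s) h) / (u * s) ^ (n + 1) := by
    rw [this]; field_simp
  rw [e, ← mul_assoc, ← pow_succ, ← MeasureTheory.integral_const_mul, tailMajorant]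
  refine MeasureTheory.setIntegral_congr_fun measurableSet_Ioi fun s hs => ?_
  have hs0 : (0 : ℝ) < s := zero_lt_one.trans hs
  rw [mul_pow]
  field_simp

theorem tail_integral_step (hn : n ≠ 0) (hφ : Monotone φ) (hφ0 : ∀ t, 0 ≤ φ t) {u : ℝ}
    (hu : 0 < u) :
    (∫ v in Set.Ioi (2 * u), φ (min v h) / v ^ (n + 1)) +
      φ (min u h) / (2 ^ (n + 1) * u ^ n) ≤ ∫ v in Set.Ioi u, φ (min v h) / v ^ (n + 1) := by
  have hint : MeasureTheory.IntegrableOn (fun v => φ (min v h) / v ^ (n + 1)) (Set.Ioi u) :=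
    integrableOn_Ioi_comp_min hn hφ hφ0 hu
  have hu2 : u ≤ 2 * u := by linarith
  rw [← Set.Ioc_union_Ioi_eq_Ioi hu2, MeasureTheory.setIntegral_union
    (Set.Ioc_disjoint_Ioi le_rfl) measurableSet_Ioi
    (hint.mono_set Set.Ioc_subset_Ioi_self) (hint.mono_set (Set.Ioi_subset_Ioi hu2)), add_comm]
  gcongr
  have h1 : ∫ v in Set.Ioc u (2 * u), φ (min u h) / (2 * u) ^ (n + 1) =
      φ (min u h) / (2 ^ (n + 1) * u ^ n) := by
    rw [MeasureTheory.setIntegral_const, Real.volume_real_Ioc_of_le hu2, smul_eq_mul, mul_pow]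
    field_simp
    ring
  rw [← h1]
  refine MeasureTheory.setIntegral_mono_on (by simp) (hint.mono_set Set.Ioc_subset_Ioi_self)
    measurableSet_Ioc fun v hv => ?_
  have hv0 : 0 < v := hu.trans hv.1
  have h2 : φ (min u h) ≤ φ (min v h) := hφ (min_le_min_right _ hv.1.le)
  have := hφ0 (min v h)
  have := hv.2
  gcongr

theorem tailMajorant_two_mul_le (hn : n ≠ 0) (hφ : Monotone φ) (hφ0 : ∀ t, 0 ≤ φ t) {u : ℝ}
    (hu : 0 < u) :
    tailMajorant n φ h (2 * u) / 2 ^ n + φ (min u h) / 2 ^ (n + 1) ≤ tailMajorant n φ h u := by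
  rw [tailMajorant_eq hu, tailMajorant_eq (by positivity : 0 < 2 * u)]
  have := mul_le_mul_of_nonneg_left (tail_integral_step (h := h) hn hφ hφ0 hu)
    (by positivity : 0 ≤ u ^ n)
  refine le_trans (le_of_eq ?_) this
  rw [mul_pow]
  field_simp

theorem le_tailMajorant (hn : n ≠ 0) (hφ : Monotone φ) (hφ0 : ∀ t, 0 ≤ φ t) {u : ℝ}
    (hu : 0 < u) (huh : u ≤ h) : (u / h) ^ n * (φ h / 2 ^ (n + 1)) ≤ tailMajorant n φ h u := by
  have hh : 0 < h := hu.trans_le huh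
  rw [tailMajorant_eq hu]
  have h1 := tail_integral_step (h := h) hn hφ hφ0 hh
  have h2 : 0 ≤ ∫ v in Set.Ioi (2 * h), φ (min v h) / v ^ (n + 1) := by
    refine MeasureTheory.setIntegral_nonneg measurableSet_Ioi fun s hs => ?_
    have : 0 < s := lt_trans (by positivity) hs
    have := hφ0 (min s h)
    positivity
  have h3 : ∫ v in Set.Ioi h, φ (min v h) / v ^ (n + 1) ≤
      ∫ v in Set.Ioi u, φ (min v h) / v ^ (n + 1) := by
    refine MeasureTheory.setIntegral_mono_set (integrableOn_Ioi_comp_min hn hφ hφ0 hu) ?_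
      (Set.Ioi_subset_Ioi huh).eventuallyLE
    refine (MeasureTheory.ae_restrict_iff' measurableSet_Ioi).2
      (Filter.Eventually.of_forall fun s hs => ?_)
    have : 0 < s := hu.trans hs
    have := hφ0 (min s h)
    simp only [Pi.zero_apply]
    positivity
  rw [min_self] at h1
  have h4 : φ h / (2 ^ (n + 1) * h ^ n) ≤ ∫ v in Set.Ioi u, φ (min v h) / v ^ (n + 1) := by
    linarith
  refine le_trans (le_of_eq ?_) (mul_le_mul_of_nonneg_left h4 (by positivity : 0 ≤ u ^ n))
  rw [div_pow]
  field_simp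

end TailMajorant

/-- A function with small differences of order `n + 2` is close to a polynomial of degree `n + 1`
in the sense of differences of order `n + 1`. -/
theorem exists_leading_coeff (n : ℕ) : ∃ C : ℝ, 0 < C ∧ ∀ (g : ℝ → ℝ) (a b : ℝ) (φ : ℝ → ℝ),
    a < b → Monotone φ → (∀ t, 0 ≤ φ t) → (∃ M, ∀ t ∈ Set.Icc a b, |g t| ≤ M) →
    (∀ u > 0, ∀ t, a ≤ t → t + (n + 2 : ℕ) * u ≤ b → |(fwdDiff u)^[n + 2] g t| ≤ φ u) →
    ∃ A : ℝ, ∀ u > 0, ∀ t, a ≤ t → t + (n + 1 : ℕ) * u ≤ b →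
      |(fwdDiff u)^[n + 1] g t - A * u ^ (n + 1)| ≤
        C * tailMajorant (n + 1) φ (b - a) u := by
  set N := 4 * (n + 2) ^ 2 with hN
  set C₁ : ℝ := 4 * (n + 2) ^ 2 + 1 + (3 * (n + 1) + 1) * 2 ^ (n + 2) with hC₁
  set C₂ : ℝ := 2 ^ ((n + 1) * N) * C₁ with hC₂
  have hC₁0 : 0 < C₁ := by positivity
  have hC₂0 : 0 < C₂ := by positivity
  refine ⟨C₂ * (2 ^ (n + 2) * (8 * (n + 2) ^ 2) ^ (n + 1)) + (n + 1) * 2 ^ (n + 2),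
    by positivity, ?_⟩
  set C := C₂ * (2 ^ (n + 2) * (8 * (n + 2) ^ 2) ^ (n + 1)) + (n + 1) * 2 ^ (n + 2) with hC
  intro g a b φ hab hφ hφ0 ⟨M, hM⟩ h
  set H := b - a with hH
  have hH0 : 0 < H := by linarith
  have hn : (0 : ℝ) ≤ n := Nat.cast_nonneg n
  set δ := H / (4 * (n + 2) ^ 2) with hδ
  have hδ0 : 0 < δ := by positivity
  have hδH : 4 * (n + 2 : ℝ) ^ 2 * δ = b - a := by rw [hδ]; field_simp; rfl
  have hstep : ∀ (k : ℕ), ∀ u > 0, ∀ t, a ≤ t → t + (k + 1 : ℕ) * u ≤ b → u ≤ H := by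
    intro k u hu t h1 h2
    push_cast at h2
    have : (0 : ℝ) ≤ k * u := by positivity
    linarith
  obtain ⟨A, hA⟩ := exists_leading_coeff_intermediate hab hM (hφ0 H) (fun u hu t h1 h2 =>
    (h u hu t h1 h2).trans (hφ (hstep (n + 1) u hu t h1 h2))) hδH
  have hlarge := abs_fwdDiff_iter_sub_le_of_large hδ0 (mul_nonneg hC₁0.le (hφ0 H)) hA N
  have hHN : H ≤ 2 ^ N * δ := by
    rw [hH, ← hδH]
    gcongr
    have : N ≤ 2 ^ N := Nat.lt_two_pow_self.le
    calc (4 * (n + 2 : ℝ) ^ 2) = (N : ℝ) := by rw [hN]; push_cast; ring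
      _ ≤ 2 ^ N := by exact_mod_cast this
  refine ⟨A, ?_⟩
  have key : ∀ K : ℕ, ∀ u > 0, δ / 2 ≤ 2 ^ K * u → ∀ t, a ≤ t → t + (n + 1 : ℕ) * u ≤ b →
      |(fwdDiff u)^[n + 1] g t - A * u ^ (n + 1)| ≤ C * tailMajorant (n + 1) φ H u := by
    intro K
    induction K with
    | zero =>
      intro u hu huδ t h1 h2
      rw [pow_zero, one_mul] at huδ
      have huH := hstep n u hu t h1 h2
      refine (hlarge u ⟨huδ, huH.trans hHN⟩ t h1 h2).trans ?_
      have h3 := le_tailMajorant n.succ_ne_zero hφ hφ0 hu huH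
      have h4 : (1 / (8 * (n + 2 : ℝ) ^ 2)) ≤ u / H := by
        rw [div_le_div_iff₀ (by positivity) hH0, one_mul, hH, ← hδH]
        have := mul_le_mul_of_nonneg_left huδ (by positivity : (0 : ℝ) ≤ 8 * (n + 2) ^ 2)
        linarith
      have h5 : (1 / (8 * (n + 2 : ℝ) ^ 2)) ^ (n + 1) * (φ H / 2 ^ (n + 2)) ≤
          tailMajorant (n + 1) φ H u := by
        refine le_trans ?_ h3
        have := hφ0 H
        gcongr
      calc 2 ^ ((n + 1) * N) * (C₁ * φ H)
          = C₂ * (2 ^ (n + 2) * (8 * (n + 2) ^ 2) ^ (n + 1)) *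
            ((1 / (8 * (n + 2 : ℝ) ^ 2)) ^ (n + 1) * (φ H / 2 ^ (n + 2))) := by
              rw [hC₂, div_pow, one_pow]; field_simp
        _ ≤ C₂ * (2 ^ (n + 2) * (8 * (n + 2) ^ 2) ^ (n + 1)) * tailMajorant (n + 1) φ H u := by
              gcongr
        _ ≤ C * tailMajorant (n + 1) φ H u := by
              have := tailMajorant_nonneg (n := n + 1) (h := H) hφ0 u
              gcongr
              rw [hC]
              have : (0 : ℝ) ≤ (n + 1) * 2 ^ (n + 2) := by positivity
              linarith
    | succ K ih =>
      intro u hu huδ t h1 h2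
      rcases le_or_gt (δ / 2) u with hu' | hu'
      · exact ih u hu (hu'.trans (le_mul_of_one_le_left hu.le (one_le_pow₀ (by norm_num))))
          t h1 h2
      have huH := hstep n u hu t h1 h2
      have h3 := abs_fwdDiff_iter_sub_le_of_small (n := n + 1)
        (E := C * tailMajorant (n + 1) φ H (2 * u) / 2 ^ (n + 1)) hu (hφ0 u) (h u hu)
        (by
          intro t h1 h2
          refine (ih (2 * u) (by linarith) ?_ t h1 h2).trans (le_of_eq ?_)
          · rw [pow_succ] at huδ
            linarith
          · field_simp)
        (by
          rw [← hδH]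
          push_cast
          have : 3 * (n + 1 : ℝ) * u ≤ 3 * (n + 1 : ℝ) * δ := by gcongr; linarith
          refine this.trans ?_
          have : 3 * (n + 1 : ℝ) ≤ 4 * (n + 2) ^ 2 := by nlinarith
          gcongr)
        h1 h2
      refine h3.trans ?_
      have h4 := tailMajorant_two_mul_le (n := n + 1) (h := H) n.succ_ne_zero hφ hφ0 hu
      rw [min_eq_left huH] at h4
      have h5 : ((n + 1 : ℕ) : ℝ) * φ u ≤ C * (φ u / 2 ^ (n + 1 + 1)) := by
        have := hφ0 u
        have e : ((n + 1 : ℕ) : ℝ) * φ u = ((n + 1) * 2 ^ (n + 2)) * (φ u / 2 ^ (n + 1 + 1)) := by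
          push_cast; field_simp
        rw [e]
        gcongr
        rw [hC]
        have : 0 ≤ C₂ * (2 ^ (n + 2) * (8 * (n + 2 : ℝ) ^ 2) ^ (n + 1)) := by positivity
        linarith
      have hC0 : 0 ≤ C := by positivity
      have h6 := mul_le_mul_of_nonneg_left h4 hC0
      rw [mul_add] at h6
      refine le_trans (add_le_add_right h5 _) (le_trans (le_of_eq ?_) h6)
      ring
  intro u hu t h1 h2
  obtain ⟨K, hK⟩ := pow_unbounded_of_one_lt (δ / 2 / u) (by norm_num : (1 : ℝ) < 2)
  exact key K u hu ((div_lt_iff₀ hu).1 hK).le t h1 h2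

/-- The weight `∏ i ∈ s, v / max v (D i)`. -/
noncomputable def knotWeight (s : Finset ℕ) (D : ℕ → ℝ) (v : ℝ) : ℝ := ∏ i ∈ s, v / max v (D i)

section KnotWeight

variable {s : Finset ℕ} {D : ℕ → ℝ}

theorem measurable_knotWeight : Measurable (knotWeight s D) := by
  unfold knotWeight
  fun_prop

theorem knotWeight_pos {v : ℝ} (hv : 0 < v) : 0 < knotWeight s D v :=
  Finset.prod_pos fun _ _ => div_pos hv (lt_max_of_lt_left hv)

theorem knotWeight_le_one {v : ℝ} (hv : 0 < v) : knotWeight s D v ≤ 1 :=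
  Finset.prod_le_one (fun _ _ => (div_pos hv (lt_max_of_lt_left hv)).le) fun _ _ =>
    (div_le_one (lt_max_of_lt_left hv)).2 (le_max_left _ _)

theorem knotWeight_eq_one {v : ℝ} (hv : 0 < v) (hD : ∀ i ∈ s, D i ≤ v) : knotWeight s D v = 1 :=
  Finset.prod_eq_one fun i hi => by rw [max_eq_left (hD i hi), div_self hv.ne']

theorem div_max_le_div_max {u v d : ℝ} (hu : 0 < u) (huv : u ≤ v) :
    u / max u d ≤ v / max v d := by
  have hv := hu.trans_le huv
  rw [div_le_div_iff₀ (lt_max_of_lt_left hu) (lt_max_of_lt_left hv)]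
  rcases le_total v d with h | h
  · rw [max_eq_right h, max_eq_right (huv.trans h)]
    exact mul_le_mul_of_nonneg_right huv (hv.le.trans h)
  · rw [max_eq_left h, mul_comm]
    exact mul_le_mul_of_nonneg_left (le_max_left _ _) hv.le

theorem knotWeight_mono {u v : ℝ} (hu : 0 < u) (huv : u ≤ v) :
    knotWeight s D u ≤ knotWeight s D v :=
  Finset.prod_le_prod (fun _ _ => (div_pos hu (lt_max_of_lt_left hu)).le) fun _ _ =>
    div_max_le_div_max hu huv

theorem knotWeight_div_le {u v : ℝ} (hu : 0 < u) (huv : u ≤ v) (hD : ∃ i ∈ s, v ≤ 4 * D i) :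
    knotWeight s D u / u ≤ 4 * (knotWeight s D v / v) := by
  obtain ⟨i, hi, hvi⟩ := hD
  have hv := hu.trans_le huv
  have h1 : u / max u (D i) / u ≤ 4 * (v / max v (D i) / v) := by
    have hmu : 0 < max u (D i) := lt_max_of_lt_left hu
    have hmv : 0 < max v (D i) := lt_max_of_lt_left hv
    have e1 : u / max u (D i) / u = 1 / max u (D i) := by field_simp
    have e2 : 4 * (v / max v (D i) / v) = 4 / max v (D i) := by field_simp
    rw [e1, e2, div_le_div_iff₀ hmu hmv, one_mul]
    refine max_le (hvi.trans ?_) ?_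
    · linarith [le_max_right u (D i)]
    · linarith [le_max_right u (D i), le_max_left u (D i)]
  have h2 : knotWeight (s.erase i) D u ≤ knotWeight (s.erase i) D v := knotWeight_mono hu huv
  have e : ∀ w, knotWeight s D w / w = knotWeight (s.erase i) D w * (w / max w (D i) / w) := by
    intro w
    rw [knotWeight, ← Finset.mul_prod_erase _ _ hi, knotWeight]
    ring
  rw [e, e, mul_left_comm]
  have := (knotWeight_pos (s := s.erase i) (D := D) hv).le
  gcongr

end KnotWeight

theorem integrableOn_Ioc_mul_div_pow {F κ : ℝ → ℝ} {a b M : ℝ} {n : ℕ} (ha : 0 < a)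
    (hF : Measurable F) (hκ : Measurable κ) (hM : ∀ v ∈ Set.Ioc a b, |F v| ≤ M)
    (hκ1 : ∀ v ∈ Set.Ioc a b, |κ v| ≤ 1) :
    MeasureTheory.IntegrableOn (fun v => F v / v ^ n * κ v) (Set.Ioc a b) := by
  refine MeasureTheory.Measure.integrableOn_of_bounded (M := M / a ^ n) (by simp) ?_ ?_
  · exact ((hF.div (measurable_id.pow_const n)).mul hκ).aestronglyMeasurable
  · refine (MeasureTheory.ae_restrict_iff' measurableSet_Ioc).2
      (Filter.Eventually.of_forall fun v hv => ?_)
    have hv0 : 0 < v := ha.trans hv.1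
    have h1 := hM v hv
    have hM0 : 0 ≤ M := (abs_nonneg _).trans h1
    rw [Real.norm_eq_abs, abs_mul, abs_div, abs_of_pos (pow_pos hv0 n)]
    calc |F v| / v ^ n * |κ v| ≤ |F v| / v ^ n * 1 := by
          gcongr; exact hκ1 v hv
      _ = |F v| / v ^ n := mul_one _
      _ ≤ M / a ^ n := by
          have := hv.1.le
          gcongr

theorem abs_setIntegral_indicator_le {κ : ℝ → ℝ} {a b v : ℝ} (ha : 0 < a)
    (hav : a < v) (hab : a ≤ b) (hκ0 : ∀ u, 0 < u → 0 ≤ κ u)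
    (hmono : ∀ u w, 0 < u → u ≤ w → κ u ≤ κ w)
    (h4 : ∀ u w, 0 < u → u ≤ w → w ≤ b → κ u / u ≤ 4 * (κ w / w)) :
    |∫ u in Set.Ioc a b, (Set.Iio v).indicator (fun u => κ u / u) u| ≤ 4 * κ v := by
  rw [MeasureTheory.setIntegral_indicator measurableSet_Iio]
  set w := min v b with hw
  have hw0 : 0 < w := lt_min (ha.trans hav) (ha.trans_le hab)
  have hsub : Set.Ioc a b ∩ Set.Iio v ⊆ Set.Ioc 0 w := fun u hu =>
    ⟨ha.trans hu.1.1, le_min hu.2.le hu.1.2⟩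
  have h1 := MeasureTheory.norm_setIntegral_le_of_norm_le_const (μ := MeasureTheory.volume)
    (s := Set.Ioc a b ∩ Set.Iio v) (f := fun u => κ u / u) (C := 4 * (κ w / w))
    (lt_of_le_of_lt (MeasureTheory.measure_mono hsub) (by simp)) (fun u hu => by
      obtain ⟨hu0, huw⟩ := hsub hu
      rw [Real.norm_eq_abs, abs_of_nonneg (div_nonneg (hκ0 u hu0) hu0.le)]
      exact h4 u w hu0 huw (min_le_right _ _))
  rw [Real.norm_eq_abs] at h1
  refine h1.trans ?_
  have h2 : MeasureTheory.volume.real (Set.Ioc a b ∩ Set.Iio v) ≤ w := by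
    refine (MeasureTheory.measureReal_mono hsub (by simp)).trans ?_
    rw [Real.volume_real_Ioc_of_le hw0.le, sub_zero]
  have := hκ0 w hw0
  calc 4 * (κ w / w) * MeasureTheory.volume.real (Set.Ioc a b ∩ Set.Iio v)
      ≤ 4 * (κ w / w) * w := by gcongr
    _ = 4 * κ w := by field_simp
    _ ≤ 4 * κ v := by
      have := hmono w v hw0 (min_le_left _ _)
      linarith

theorem setIntegral_mul_tail_le {w κ : ℝ → ℝ} {a b : ℝ} (ha : 0 < a) (hab : a ≤ b)
    (hw : MeasureTheory.IntegrableOn w (Set.Ioi a)) (hw0 : ∀ v ∈ Set.Ioi a, 0 ≤ w v)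
    (hκm : Measurable κ) (hκ0 : ∀ u, 0 < u → 0 ≤ κ u) (hκ1 : ∀ u, 0 < u → κ u ≤ 1)
    (hmono : ∀ u w, 0 < u → u ≤ w → κ u ≤ κ w)
    (h4 : ∀ u w, 0 < u → u ≤ w → w ≤ b → κ u / u ≤ 4 * (κ w / w)) :
    ∫ u in Set.Ioc a b, κ u / u * ∫ v in Set.Ioi u, w v ≤ 4 * ∫ v in Set.Ioi a, w v * κ v := by
  have hκint : MeasureTheory.IntegrableOn (fun u => κ u / u) (Set.Ioc a b) := by
    have := integrableOn_Ioc_mul_div_pow (F := fun _ => 1) (M := 1) (n := 1) (b := b) ha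
      measurable_const hκm (by simp)
      (fun v hv => by
        have hv0 := ha.trans hv.1
        rw [abs_of_nonneg (hκ0 v hv0)]; exact hκ1 v hv0)
    refine this.congr_fun (fun v _ => ?_) measurableSet_Ioc
    dsimp only
    rw [pow_one]; ring
  have hprod := (hκint.mul_prod hw).indicator
    (measurableSet_lt (measurable_fst : Measurable (Prod.fst : ℝ × ℝ → ℝ)) measurable_snd)
  have hswap := MeasureTheory.integral_integral_swap
    (f := fun u v => ({z : ℝ × ℝ | z.1 < z.2}).indicator (fun z => κ z.1 / z.1 * w z.2) (u, v))
    hprod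
  have e1 : ∫ u in Set.Ioc a b, κ u / u * ∫ v in Set.Ioi u, w v =
      ∫ u in Set.Ioc a b, ∫ v in Set.Ioi a,
        ({z : ℝ × ℝ | z.1 < z.2}).indicator (fun z => κ z.1 / z.1 * w z.2) (u, v) := by
    refine MeasureTheory.setIntegral_congr_fun measurableSet_Ioc fun u hu => ?_
    rw [← MeasureTheory.integral_const_mul]
    have : ∀ v, ({z : ℝ × ℝ | z.1 < z.2}).indicator (fun z => κ z.1 / z.1 * w z.2) (u, v) =
        (Set.Ioi u).indicator (fun v => κ u / u * w v) v := fun v => rfl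
    simp only [this]
    rw [MeasureTheory.setIntegral_indicator measurableSet_Ioi,
      Set.inter_eq_self_of_subset_right (Set.Ioi_subset_Ioi hu.1.le)]
  rw [e1, hswap, ← MeasureTheory.integral_const_mul]
  have hwκ : MeasureTheory.IntegrableOn (fun v => w v * κ v) (Set.Ioi a) := by
    refine MeasureTheory.Integrable.mul_bdd (c := 1) hw hκm.aestronglyMeasurable ?_
    refine (MeasureTheory.ae_restrict_iff' measurableSet_Ioi).2
      (Filter.Eventually.of_forall fun v hv => ?_)
    have hv0 : 0 < v := ha.trans hv
    rw [Real.norm_eq_abs, abs_of_nonneg (hκ0 v hv0)]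
    exact hκ1 v hv0
  refine MeasureTheory.setIntegral_mono_on hprod.integral_prod_right (hwκ.const_mul 4)
    measurableSet_Ioi fun v hv => ?_
  have : ∀ u, ({z : ℝ × ℝ | z.1 < z.2}).indicator (fun z => κ z.1 / z.1 * w z.2) (u, v) =
      (Set.Iio v).indicator (fun u => κ u / u) u * w v := fun u => by
    by_cases huv : u < v <;> simp [Set.indicator, huv]
  simp only [this]
  rw [MeasureTheory.integral_mul_const]
  have h5 := (le_abs_self _).trans (abs_setIntegral_indicator_le ha hv hab hκ0 hmono h4)
  have := mul_le_mul_of_nonneg_right h5 (hw0 v hv)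
  linarith

theorem setIntegral_tailMajorant_le {n : ℕ} (hn : n ≠ 0) : ∃ c : ℝ, 0 < c ∧
    ∀ (φ : ℝ → ℝ) (h h' a d : ℝ) (s : Finset ℕ) (D : ℕ → ℝ), Monotone φ → (∀ t, 0 ≤ φ t) →
    0 < a → a ≤ h' → h' ≤ h → d ≤ h → (∀ i ∈ s, D i ≤ h) → (∃ i ∈ s, h' ≤ 2 * D i) →
    ∫ u in Set.Ioc a (2 * h'), tailMajorant n φ h u / u ^ (n + 1) * knotWeight s D u ≤
      c * h * ∫ v in Set.Ioc a (2 * h), φ v / v ^ (n + 2) * (knotWeight s D v * (v / max v d)) := by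
  set K : ℝ := ∫ s in Set.Ioi (1 : ℝ), 1 / s ^ (n + 1) with hK
  have hK0 : 0 ≤ K := MeasureTheory.setIntegral_nonneg measurableSet_Ioi fun s hs => by
    have : (0 : ℝ) < s := zero_lt_one.trans hs
    positivity
  refine ⟨4 * (2 + 4 * K), by positivity, ?_⟩
  intro φ h h' a d s D hφ hφ0 ha hah' hh' hd hD hDi
  have hh : 0 < h := ha.trans_le (hah'.trans hh')
  have ha2 : a ≤ 2 * h := by linarith
  set w : ℝ → ℝ := fun v => φ (min v h) / v ^ (n + 1) with hw
  have hwint : ∀ c, 0 < c → MeasureTheory.IntegrableOn w (Set.Ioi c) := fun c hc =>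
    integrableOn_Ioi_comp_min hn hφ hφ0 hc
  have hw0 : ∀ v, 0 < v → 0 ≤ w v := fun v hv => by
    have := hφ0 (min v h)
    simp only [hw]; positivity
  have e1 : ∫ u in Set.Ioc a (2 * h'), tailMajorant n φ h u / u ^ (n + 1) * knotWeight s D u =
      ∫ u in Set.Ioc a (2 * h'), knotWeight s D u / u * ∫ v in Set.Ioi u, w v := by
    refine MeasureTheory.setIntegral_congr_fun measurableSet_Ioc fun u hu => ?_
    have hu0 : 0 < u := ha.trans hu.1
    rw [tailMajorant_eq hu0, pow_succ]
    field_simp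
    exact mul_comm _ _
  have h1 := setIntegral_mul_tail_le (κ := knotWeight s D) (b := 2 * h') ha (by linarith)
    (hwint a ha) (fun v hv => hw0 v (ha.trans hv)) measurable_knotWeight
    (fun u hu => (knotWeight_pos hu).le) (fun u hu => knotWeight_le_one hu)
    (fun u v hu huv => knotWeight_mono hu huv)
    (fun u v hu huv hv => knotWeight_div_le hu huv (by
      obtain ⟨i, hi, hi'⟩ := hDi
      exact ⟨i, hi, by linarith⟩))
  set J := ∫ v in Set.Ioc a (2 * h), φ v / v ^ (n + 2) * (knotWeight s D v * (v / max v d))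
    with hJ
  have hκm : Measurable fun v => knotWeight s D v * (v / max v d) :=
    measurable_knotWeight.mul (by fun_prop)
  have hκ01 : ∀ v, 0 < v → 0 ≤ knotWeight s D v * (v / max v d) ∧
      knotWeight s D v * (v / max v d) ≤ 1 := fun v hv => by
    have h1 := knotWeight_pos (s := s) (D := D) hv
    have h2 := knotWeight_le_one (s := s) (D := D) hv
    have h3 : 0 < v / max v d := div_pos hv (lt_max_of_lt_left hv)
    have h4 : v / max v d ≤ 1 := (div_le_one (lt_max_of_lt_left hv)).2 (le_max_left _ _)
    exact ⟨by positivity, mul_le_one₀ h2 h3.le h4⟩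
  have hJint : MeasureTheory.IntegrableOn
      (fun v => φ v / v ^ (n + 2) * (knotWeight s D v * (v / max v d))) (Set.Ioc a (2 * h)) :=
    integrableOn_Ioc_mul_div_pow (M := φ (2 * h)) ha hφ.measurable hκm
      (fun v hv => by rw [abs_of_nonneg (hφ0 v)]; exact hφ hv.2)
      (fun v hv => by
        obtain ⟨h1, h2⟩ := hκ01 v (ha.trans hv.1)
        rw [abs_of_nonneg h1]; exact h2)
  have hwκ : MeasureTheory.IntegrableOn (fun v => w v * knotWeight s D v) (Set.Ioi a) := by
    refine MeasureTheory.Integrable.mul_bdd (c := 1) (hwint a ha)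
      measurable_knotWeight.aestronglyMeasurable ?_
    refine (MeasureTheory.ae_restrict_iff' measurableSet_Ioi).2
      (Filter.Eventually.of_forall fun v hv => ?_)
    have hv0 : 0 < v := ha.trans hv
    rw [Real.norm_eq_abs, abs_of_nonneg (knotWeight_pos hv0).le]
    exact knotWeight_le_one hv0
  have h2 : ∫ v in Set.Ioc a (2 * h), w v * knotWeight s D v ≤ 2 * h * J := by
    rw [hJ, ← MeasureTheory.integral_const_mul]
    refine MeasureTheory.setIntegral_mono_on (hwκ.mono_set Set.Ioc_subset_Ioi_self)
      (hJint.const_mul _) measurableSet_Ioc fun v hv => ?_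
    have hv0 : 0 < v := ha.trans hv.1
    have hmax : max v d ≤ 2 * h := max_le hv.2 (by linarith)
    have hmax0 : 0 < max v d := lt_max_of_lt_left hv0
    have hk0 := (knotWeight_pos (s := s) (D := D) hv0).le
    have e : 2 * h * (φ v / v ^ (n + 2) * (knotWeight s D v * (v / max v d))) =
        φ v / v ^ (n + 1) * knotWeight s D v * (2 * h / max v d) := by
      rw [pow_succ v (n + 1)]; field_simp
    rw [e]
    have h3 : 1 ≤ 2 * h / max v d := (one_le_div hmax0).2 hmax
    have h4 : φ (min v h) ≤ φ v := hφ (min_le_left _ _)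
    have h5 := hφ0 v
    calc w v * knotWeight s D v ≤ φ v / v ^ (n + 1) * knotWeight s D v := by
          simp only [hw]; gcongr
      _ ≤ _ := le_mul_of_one_le_right (by positivity) h3
  have h3 : ∫ v in Set.Ioi (2 * h), w v * knotWeight s D v ≤ φ h * K / (2 * h) ^ n := by
    have hh2 : 0 < 2 * h := by positivity
    have e := tailMajorant_eq (n := n) (φ := fun _ => φ h) (h := h) hh2
    have e' : tailMajorant n (fun _ => φ h) h (2 * h) = φ h * K := by
      rw [tailMajorant, hK, ← MeasureTheory.integral_const_mul]
      refine MeasureTheory.setIntegral_congr_fun measurableSet_Ioi fun v _ => ?_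
      ring
    rw [e'] at e
    rw [e, mul_div_cancel_left₀ _ (by positivity)]
    refine MeasureTheory.setIntegral_mono_on
      (hwκ.mono_set (Set.Ioi_subset_Ioi ha2)) ?_ measurableSet_Ioi fun v hv => ?_
    · exact integrableOn_Ioi_comp_min (φ := fun _ => φ h) (h := h) hn monotone_const
        (fun _ => hφ0 h) hh2
    · have hv0 : 0 < v := hh2.trans hv
      refine (mul_le_of_le_one_right (hw0 v hv0) (knotWeight_le_one hv0)).trans ?_
      have : φ (min v h) ≤ φ h := hφ (min_le_right _ _)
      simp only [hw]
      gcongr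
  have h4 : φ h / (2 ^ (n + 2) * h ^ n) ≤ h * J := by
    have e : ∫ v in Set.Ioc h (2 * h), φ h / (2 * h) ^ (n + 2) =
        φ h / (2 ^ (n + 2) * h ^ n) / h := by
      rw [MeasureTheory.setIntegral_const, Real.volume_real_Ioc_of_le (by linarith),
        smul_eq_mul, mul_pow, pow_add h n 2]
      field_simp
      ring
    have h5 : φ h / (2 ^ (n + 2) * h ^ n) / h ≤ J := by
      rw [← e]
      have hsub : Set.Ioc h (2 * h) ⊆ Set.Ioc a (2 * h) :=
        Set.Ioc_subset_Ioc_left (hah'.trans hh')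
      refine (MeasureTheory.setIntegral_mono_on (by simp) (hJint.mono_set hsub)
        measurableSet_Ioc fun v hv => ?_).trans
        (MeasureTheory.setIntegral_mono_set hJint ?_ hsub.eventuallyLE)
      · have hv0 : 0 < v := hh.trans hv.1
        rw [knotWeight_eq_one hv0 fun i hi => (hD i hi).trans hv.1.le,
          max_eq_left (hd.trans hv.1.le), div_self hv0.ne', mul_one, mul_one]
        have := hφ0 v
        have h6 : φ h ≤ φ v := hφ hv.1.le
        have := hv.2
        gcongr
      · refine (MeasureTheory.ae_restrict_iff' measurableSet_Ioc).2
          (Filter.Eventually.of_forall fun v hv => ?_)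
        have hv0 : 0 < v := ha.trans hv.1
        have := hφ0 v
        have := (hκ01 v hv0).1
        simp only [Pi.zero_apply]
        positivity
    rwa [div_le_iff₀' hh] at h5
  have h6 : φ h * K / (2 * h) ^ n ≤ 4 * K * (h * J) := by
    refine le_trans (le_of_eq ?_) (mul_le_mul_of_nonneg_left h4 (by positivity : 0 ≤ 4 * K))
    rw [mul_pow, pow_add 2 n 2]
    field_simp
    norm_num
  rw [e1]
  refine h1.trans ?_
  have e7 : ∫ v in Set.Ioi a, w v * knotWeight s D v =
      (∫ v in Set.Ioc a (2 * h), w v * knotWeight s D v) +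
        ∫ v in Set.Ioi (2 * h), w v * knotWeight s D v := by
    rw [← Set.Ioc_union_Ioi_eq_Ioi ha2, MeasureTheory.setIntegral_union
      (Set.Ioc_disjoint_Ioi le_rfl) measurableSet_Ioi
      (hwκ.mono_set Set.Ioc_subset_Ioi_self) (hwκ.mono_set (Set.Ioi_subset_Ioi ha2))]
  rw [e7]
  linarith

/-- The contribution of the anchor `p` to `knotSum`. -/
noncomputable def knotTerm (m r n : ℕ) (x : ℕ → ℝ) (φ : ℝ → ℝ) (p : ℕ) : ℝ :=
  ∫ v in Set.Ioc (x (p + r + 1) - x p) (2 * (x m - x 0)),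
    φ v / v ^ (n + 1) * knotWeight (Finset.range (m + 1)) (fun i => |x i - x p|) v

/-- A sum of one-dimensional integrals controlling the divided difference. -/
noncomputable def knotSum (m r n : ℕ) (x : ℕ → ℝ) (φ : ℝ → ℝ) : ℝ :=
  ∑ p ∈ Finset.range n, knotTerm m r n x φ p

theorem knotTerm_nonneg {m r n : ℕ} {x : ℕ → ℝ} {φ : ℝ → ℝ} {p : ℕ} (hφ0 : ∀ t, 0 ≤ φ t)
    (hp : x p < x (p + r + 1)) : 0 ≤ knotTerm m r n x φ p := by
  refine MeasureTheory.setIntegral_nonneg measurableSet_Ioc fun v hv => ?_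
  have hv0 : 0 < v := (sub_pos.2 hp).trans hv.1
  have := hφ0 v
  have := (knotWeight_pos (s := Finset.range (m + 1)) (D := fun i => |x i - x p|) hv0).le
  positivity

theorem knotTerm_const_mul (m r n : ℕ) (x : ℕ → ℝ) (φ : ℝ → ℝ) (p : ℕ) (C : ℝ) :
    knotTerm m r n x (fun t => C * φ t) p = C * knotTerm m r n x φ p := by
  rw [knotTerm, knotTerm, ← MeasureTheory.integral_const_mul]
  congr 1
  funext v
  ring

theorem abs_sub_le_of_sorted {x : ℕ → ℝ} {m i j : ℕ} (hx : ∀ i j, i ≤ j → j ≤ m → x i ≤ x j)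
    (hi : i ≤ m) (hj : j ≤ m) : |x i - x j| ≤ x m - x 0 := by
  have := hx 0 i (by omega) hi
  have := hx 0 j (by omega) hj
  have := hx i m hi le_rfl
  have := hx j m hj le_rfl
  rw [abs_le]
  constructor <;> linarith

theorem exists_le_two_mul_abs_sub {m : ℕ} (x : ℕ → ℝ) (y : ℝ) :
    ∃ i ∈ Finset.range (m + 1), x m - x 0 ≤ 2 * |x i - y| := by
  have h1 := neg_abs_le (x 0 - y)
  have h2 := le_abs_self (x m - y)
  rcases le_total (x m - x 0) (2 * |x m - y|) with h | h
  · exact ⟨m, by simp, h⟩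
  · exact ⟨0, by simp, by linarith⟩

theorem knotTerm_init_le {n : ℕ} (hn : n ≠ 0) : ∃ c : ℝ, 0 < c ∧
    ∀ (m r : ℕ) (x : ℕ → ℝ) (φ : ℝ → ℝ) (p : ℕ), (∀ i j, i ≤ j → j ≤ m + 1 → x i ≤ x j) →
    Monotone φ → (∀ t, 0 ≤ φ t) → p + r + 1 ≤ m → x p < x (p + r + 1) →
    knotTerm m r n x (tailMajorant n φ (x (m + 1) - x 0)) p ≤
      c * (x (m + 1) - x 0) * knotTerm (m + 1) r (n + 1) x φ p := by
  obtain ⟨c, hc, H⟩ := setIntegral_tailMajorant_le hn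
  refine ⟨c, hc, fun m r x φ p hx hφ hφ0 hp hxp => ?_⟩
  have hx' : ∀ i j, i ≤ j → j ≤ m → x i ≤ x j := fun i j hij hj => hx i j hij (by omega)
  have h1 := hx' 0 p (by omega) (by omega)
  have h2 := hx' (p + r + 1) m hp le_rfl
  have h3 := hx m (m + 1) (by omega) le_rfl
  have := H φ (x (m + 1) - x 0) (x m - x 0) (x (p + r + 1) - x p) |x (m + 1) - x p|
    (Finset.range (m + 1)) (fun i => |x i - x p|) hφ hφ0 (by linarith) (by linarith) (by linarith)
    (abs_sub_le_of_sorted hx le_rfl (by omega))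
    (fun i hi => abs_sub_le_of_sorted hx (by have := Finset.mem_range.1 hi; omega) (by omega))
    (exists_le_two_mul_abs_sub x (x p))
  refine this.trans (le_of_eq ?_)
  rw [knotTerm]
  simp only [knotWeight, Finset.prod_range_succ _ (m + 1)]

theorem knotTerm_tail_le {n : ℕ} (hn : n ≠ 0) : ∃ c : ℝ, 0 < c ∧
    ∀ (m r : ℕ) (x : ℕ → ℝ) (φ : ℝ → ℝ) (p : ℕ), (∀ i j, i ≤ j → j ≤ m + 1 → x i ≤ x j) →
    Monotone φ → (∀ t, 0 ≤ φ t) → p + r + 1 ≤ m → x (p + 1) < x (p + 1 + r + 1) →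
    knotTerm m r n (fun i => x (i + 1)) (tailMajorant n φ (x (m + 1) - x 0)) p ≤
      c * (x (m + 1) - x 0) * knotTerm (m + 1) r (n + 1) x φ (p + 1) := by
  obtain ⟨c, hc, H⟩ := setIntegral_tailMajorant_le hn
  refine ⟨c, hc, fun m r x φ p hx hφ hφ0 hp hxp => ?_⟩
  have e : p + r + 1 + 1 = p + 1 + r + 1 := by omega
  have h1 := hx 1 (p + 1) (by omega) (by omega)
  have h2 := hx (p + 1 + r + 1) (m + 1) (by omega) le_rfl
  have h3 := hx 0 1 (by omega) (by omega)
  have := H φ (x (m + 1) - x 0) (x (m + 1) - x 1) (x (p + 1 + r + 1) - x (p + 1))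
    |x 0 - x (p + 1)| (Finset.range (m + 1)) (fun i => |x (i + 1) - x (p + 1)|) hφ hφ0
    (by linarith) (by linarith) (by linarith)
    (abs_sub_le_of_sorted hx (by omega) (by omega))
    (fun i hi => abs_sub_le_of_sorted hx (by have := Finset.mem_range.1 hi; omega) (by omega))
    (exists_le_two_mul_abs_sub (fun i => x (i + 1)) (x (p + 1)))
  rw [knotTerm, e]
  refine this.trans (le_of_eq ?_)
  rw [knotTerm]
  simp only [knotWeight, Finset.prod_range_succ' _ (m + 1)]

open Polynomial in
theorem exists_polynomial_iterate_derivative (r k : ℕ) (A : ℝ) : ∃ P : ℝ[X],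
    P.degree ≤ (k + r : ℕ) ∧ ∀ t, (derivative^[r] P).eval t = A * t ^ k := by
  have h0 : (((k + r).descFactorial r : ℕ) : ℝ) ≠ 0 := by
    have := Nat.pow_sub_le_descFactorial (k + r) r
    have h1 : 0 < (k + r + 1 - r) ^ r := by
      rw [show k + r + 1 - r = k + 1 by omega]; positivity
    exact_mod_cast (h1.trans_le this).ne'
  refine ⟨C (A / ((k + r).descFactorial r : ℕ)) * X ^ (k + r), degree_C_mul_X_pow_le _ _, ?_⟩
  intro t
  rw [iterate_derivative_C_mul, iterate_derivative_X_pow_eq_natCast_mul]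
  simp only [eval_mul, eval_C, eval_natCast, eval_pow, eval_X, Nat.add_sub_cancel]
  field_simp

theorem fwdDiff_iter_sub_pow (n : ℕ) (A : ℝ) (g : ℝ → ℝ) (u t : ℝ) :
    (fwdDiff u)^[n] (fun t => g t - A / n.factorial * t ^ n) t =
      (fwdDiff u)^[n] g t - A * u ^ n := by
  have h1 : (fwdDiff u)^[n] (fun t : ℝ => t ^ n) t = n.factorial * u ^ n := by
    rcases eq_or_ne u 0 with rfl | hu
    · rcases n with _ | n
      · simp
      · rw [← mixedDiff_replicate, mixedDiff_eq_zero (by simp)]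
        simp
    · have h2 := congrFun (fwdDiff_iter_eq_factorial (R := ℝ) (n := n)) (t / u)
      rw [fwdDiff_iter_eq_sum_shift] at h2 ⊢
      have h3 : ∀ k : ℕ, t + k • u = u * (t / u + k • 1) := fun k => by
        simp only [nsmul_eq_mul]; field_simp
      simp only [h3, mul_pow, zsmul_eq_mul, mul_left_comm _ (u ^ n)] at h2 ⊢
      rw [← Finset.mul_sum, h2, mul_comm]
      simp
  have h2 : (fun t => g t - A / n.factorial * t ^ n) =
      g + (-(A / n.factorial)) • (fun t : ℝ => t ^ n) := by
    funext t
    simp only [Pi.add_apply, Pi.smul_apply, smul_eq_mul]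
    ring
  rw [h2, fwdDiff_iter_add, fwdDiff_iter_const_smul]
  simp only [Pi.add_apply, Pi.smul_apply, smul_eq_mul]
  rw [h1]
  have : (n.factorial : ℝ) ≠ 0 := by exact_mod_cast n.factorial_ne_zero
  field_simp
  ring

theorem abs_divDiff_le_knotSum (r k : ℕ) : ∃ c : ℝ, 0 < c ∧ ∀ x : ℕ → ℝ,
    (∀ i j, i ≤ j → j ≤ r + k + 1 → x i ≤ x j) →
    (∀ j, j + r + 1 ≤ r + k + 1 → x j < x (j + r + 1)) →
    ∀ F : ℕ → ℝ → ℝ, IsDerivData r F (x 0) (x (r + k + 1)) →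
    (∃ M, ∀ t ∈ Set.Icc (x 0) (x (r + k + 1)), |F r t| ≤ M) →
    ∀ φ : ℝ → ℝ, Monotone φ → (∀ t, 0 ≤ φ t) →
    (∀ u > 0, ∀ t, x 0 ≤ t → t + (k + 1 : ℕ) * u ≤ x (r + k + 1) →
      |(fwdDiff u)^[k + 1] (F r) t| ≤ φ u) →
    |divDiff F (List.ofFn fun i : Fin (r + k + 1 + 1) => x i)| ≤
      c * knotSum (r + k + 1) r (k + 1) x φ := by
  induction k with
  | zero =>
    refine ⟨8, by norm_num, fun x hx hxr F hF _ φ hφ hφ0 h => ?_⟩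
    have h0 := hxr 0 (by omega)
    rw [show 0 + r + 1 = r + 0 + 1 by omega] at h0
    set m := r + 0 + 1 with hm
    set H := x m - x 0 with hH
    have hH0 : 0 < H := sub_pos.2 h0
    obtain ⟨P, hPdeg, hP⟩ := exists_polynomial_iterate_derivative r 0 (F r (x 0))
    have hG := hF.sub_polynomial P
    have hGM : ∀ t ∈ Set.Icc (x 0) (x m),
        |F r t - (Polynomial.derivative^[r] P).eval t| ≤ φ H := by
      rintro t ⟨h1, h2⟩
      rw [hP, pow_zero, mul_one]
      rcases eq_or_lt_of_le h1 with rfl | h1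
      · simpa using hφ0 H
      · have := h (t - x 0) (by linarith) (x 0) le_rfl (by simpa using h2)
        rw [zero_add, Function.iterate_one, fwdDiff, add_sub_cancel] at this
        exact this.trans (hφ (by linarith))
    have b1 := abs_divDiff_le (x := x) (fun i j hij hj => hx i j hij (by omega))
      (fun i hi => ⟨hx 0 i (by omega) (by omega), hx i m (by omega) le_rfl⟩) hG hGM
    have b2 := abs_divDiff_le (x := fun i => x (i + 1))
      (fun i j hij hj => hx (i + 1) (j + 1) (by omega) (by omega))
      (fun i hi => ⟨hx 0 (i + 1) (by omega) (by omega), hx (i + 1) m (by omega) le_rfl⟩) hG hGM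
    rw [← divDiff_sub_polynomial F P (by simp [List.ofFn_succ]) (by
      rw [List.length_ofFn]
      exact hPdeg.trans_lt (by exact_mod_cast (by omega))), divDiff_ofFn_succ _ x _ h0.ne,
      abs_div, abs_of_pos hH0, div_le_iff₀ hH0]
    have b3 : φ H / (4 * H) ≤ knotSum m r (0 + 1) x φ := by
      rw [knotSum, Finset.sum_range_succ, Finset.sum_range_zero, zero_add, knotTerm,
        show 0 + r + 1 = m by omega]
      have e : ∫ v in Set.Ioc H (2 * H), φ H / (2 * H) ^ 2 = φ H / (4 * H) := by
        rw [MeasureTheory.setIntegral_const, Real.volume_real_Ioc_of_le (by linarith),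
          smul_eq_mul]
        field_simp
        ring
      rw [← e]
      refine MeasureTheory.setIntegral_mono_on (by simp) ?_ measurableSet_Ioc fun v hv => ?_
      · exact integrableOn_Ioc_mul_div_pow (M := φ (2 * H)) hH0 hφ.measurable
          measurable_knotWeight
          (fun v hv => by rw [abs_of_nonneg (hφ0 v)]; exact hφ hv.2)
          (fun v hv => by
            rw [abs_of_nonneg (knotWeight_pos (hH0.trans hv.1)).le]
            exact knotWeight_le_one (hH0.trans hv.1))
      · have hv0 : 0 < v := hH0.trans hv.1
        rw [knotWeight_eq_one hv0 fun i hi => ?_, mul_one]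
        · have := hφ0 H
          have h6 : φ H ≤ φ v := hφ hv.1.le
          have := hφ0 v
          have := hv.2
          norm_num only
          gcongr
        · exact (abs_sub_le_of_sorted hx (by have := Finset.mem_range.1 hi; omega)
            (Nat.zero_le _)).trans hv.1.le
    have b4 := mul_le_mul_of_nonneg_right b3 (by positivity : 0 ≤ 8 * H)
    have e4 : φ H / (4 * H) * (8 * H) = 2 * φ H := by field_simp; ring
    rw [e4] at b4
    refine (abs_sub _ _).trans ?_
    linarith
  | succ k ih =>
    obtain ⟨c, hc, ih⟩ := ih
    obtain ⟨C, hC, hMW⟩ := exists_leading_coeff k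
    obtain ⟨c₁, hc₁, hinit⟩ := knotTerm_init_le k.succ_ne_zero
    obtain ⟨c₂, hc₂, htail⟩ := knotTerm_tail_le k.succ_ne_zero
    refine ⟨c * C * (c₁ + c₂), by positivity, fun x hx hxr F hF hb φ hφ hφ0 h => ?_⟩
    set m := r + k + 1 with hm
    have hm' : r + (k + 1) + 1 = m + 1 := by omega
    rw [hm'] at hx hxr hF hb h ⊢
    have hlt : x 0 < x (m + 1) := by
      have h1 := hxr 0 (by omega)
      exact h1.trans_le (hx _ _ (by omega) le_rfl)
    set H := x (m + 1) - x 0 with hH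
    have hH0 : 0 < H := sub_pos.2 hlt
    obtain ⟨A, hA⟩ := hMW (F r) (x 0) (x (m + 1)) φ hlt hφ hφ0 hb h
    obtain ⟨P, hPdeg, hP⟩ :=
      exists_polynomial_iterate_derivative r (k + 1) (A / (k + 1).factorial)
    have hG := hF.sub_polynomial P
    set G : ℕ → ℝ → ℝ := fun j t => F j t - (Polynomial.derivative^[j] P).eval t with hGdef
    have hGb : ∃ M, ∀ t ∈ Set.Icc (x 0) (x (m + 1)), |G r t| ≤ M := by
      obtain ⟨M, hM⟩ := hb
      obtain ⟨M', hM'⟩ := isCompact_Icc.exists_bound_of_continuousOn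
        ((Polynomial.derivative^[r] P).continuousOn (s := Set.Icc (x 0) (x (m + 1))))
      refine ⟨M + M', fun t ht => (abs_sub _ _).trans (add_le_add (hM t ht) ?_)⟩
      simpa using hM' t ht
    set Φ : ℝ → ℝ := fun u => C * tailMajorant (k + 1) φ H u with hΦ
    have hΦm : Monotone Φ := (monotone_tailMajorant k.succ_ne_zero hφ hφ0).const_mul hC.le
    have hΦ0 : ∀ t, 0 ≤ Φ t := fun t => mul_nonneg hC.le (tailMajorant_nonneg hφ0 t)
    have hGd : ∀ u > 0, ∀ t, x 0 ≤ t → t + (k + 1 : ℕ) * u ≤ x (m + 1) →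
        |(fwdDiff u)^[k + 1] (G r) t| ≤ Φ u := by
      intro u hu t h1 h2
      have e : G r = fun t => F r t - A / (k + 1).factorial * t ^ (k + 1) := by
        funext t; simp only [hGdef, hP]
      rw [e, fwdDiff_iter_sub_pow]
      exact hA u hu t h1 h2
    have hx1 : x 0 ≤ x 1 := hx 0 1 (by omega) (by omega)
    have hxm : x m ≤ x (m + 1) := hx m (m + 1) (by omega) le_rfl
    have b1 := ih x (fun i j hij hj => hx i j hij (by omega))
      (fun j hj => hxr j (by omega)) G (hG.mono le_rfl hxm)
      (hGb.imp fun M hM t ht => hM t ⟨ht.1, ht.2.trans hxm⟩) Φ hΦm hΦ0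
      (fun u hu t h1 h2 => hGd u hu t h1 (h2.trans hxm))
    have b2 := ih (fun i => x (i + 1)) (fun i j hij hj => hx _ _ (by omega) (by omega))
      (fun j hj => by
        have := hxr (j + 1) (by omega)
        rwa [show j + 1 + r + 1 = j + r + 1 + 1 by omega] at this)
      G (hG.mono hx1 le_rfl)
      (hGb.imp fun M hM t ht => hM t ⟨hx1.trans ht.1, ht.2⟩) Φ hΦm hΦ0
      (fun u hu t h1 h2 => hGd u hu t (hx1.trans h1) h2)
    have hnn : ∀ p < k + 1 + 1, 0 ≤ knotTerm (m + 1) r (k + 1 + 1) x φ p := fun p hp =>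
      knotTerm_nonneg hφ0 (hxr p (by omega))
    have s1 : knotSum m r (k + 1) x Φ ≤
        C * (c₁ * H * knotSum (m + 1) r (k + 1 + 1) x φ) := by
      rw [knotSum, knotSum, Finset.mul_sum, Finset.mul_sum, Finset.sum_range_succ _ (k + 1)]
      refine le_add_of_le_of_nonneg (Finset.sum_le_sum fun p hp => ?_) ?_
      · have hp' := Finset.mem_range.1 hp
        rw [hΦ, knotTerm_const_mul]
        have := hinit m r x φ p hx hφ hφ0 (by omega) (hxr p (by omega))
        gcongr
      · have := hnn (k + 1) (by omega)
        positivity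
    have s2 : knotSum m r (k + 1) (fun i => x (i + 1)) Φ ≤
        C * (c₂ * H * knotSum (m + 1) r (k + 1 + 1) x φ) := by
      rw [knotSum, knotSum, Finset.mul_sum, Finset.mul_sum, Finset.sum_range_succ' _ (k + 1)]
      refine le_add_of_le_of_nonneg (Finset.sum_le_sum fun p hp => ?_) ?_
      · have hp' := Finset.mem_range.1 hp
        rw [hΦ, knotTerm_const_mul]
        have := htail m r x φ p hx hφ hφ0 (by omega) (hxr (p + 1) (by omega))
        gcongr
      · have := hnn 0 (by omega)
        positivity
    rw [← divDiff_sub_polynomial F P (by simp [List.ofFn_succ]) (by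
      rw [List.length_ofFn]
      exact hPdeg.trans_lt (by exact_mod_cast (by omega))), divDiff_ofFn_succ _ x _ hlt.ne,
      abs_div, abs_of_pos hH0, div_le_iff₀ hH0]
    refine (abs_sub _ _).trans ((add_le_add b2 b1).trans ?_)
    have s1' := mul_le_mul_of_nonneg_left s1 hc.le
    have s2' := mul_le_mul_of_nonneg_left s2 hc.le
    refine (add_le_add s2' s1').trans (le_of_eq ?_)
    ring

section LamEstimates

variable {m r : ℕ} {x : ℕ → ℝ} {φ : ℝ → ℝ}

theorem exists_pair_lt_le_dpq (hx : ∀ i j, i ≤ j → j ≤ m → x i ≤ x j) {p : ℕ}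
    (hp : p + r + 1 ≤ m) {v : ℝ} (hv : x (p + r + 1) - x p < v) (hv' : v ≤ 2 * (x m - x 0)) :
    ∃ a b : ℕ, a ≤ p ∧ p + r + 1 ≤ b ∧ b ≤ m ∧ x b - x a < v ∧ v ≤ dpq m x a b := by
  let S : Finset (ℕ × ℕ) := (Finset.range (p + 1) ×ˢ Finset.Icc (p + r + 1) m).filter
    fun c => x c.2 - x c.1 < v
  have hmem : ∀ a b, (a, b) ∈ S ↔ (a ≤ p ∧ p + r + 1 ≤ b ∧ b ≤ m) ∧ x b - x a < v := by
    intro a b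
    simp only [S, Finset.mem_filter, Finset.mem_product, Finset.mem_range, Finset.mem_Icc]
    constructor
    · rintro ⟨⟨h1, h2, h3⟩, h4⟩
      exact ⟨⟨by omega, h2, h3⟩, h4⟩
    · rintro ⟨⟨h1, h2, h3⟩, h4⟩
      exact ⟨⟨by omega, h2, h3⟩, h4⟩
  obtain ⟨⟨a, b⟩, hab, hmax⟩ := S.exists_max_image (fun c => c.2 + (p - c.1))
    ⟨(p, p + r + 1), (hmem _ _).2 ⟨⟨le_rfl, le_rfl, hp⟩, hv⟩⟩
  obtain ⟨⟨h1, h2, h3⟩, h4⟩ := (hmem _ _).1 hab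
  have hright : b < m → v ≤ x (b + 1) - x a := by
    intro hb
    by_contra hlt
    have := hmax (a, b + 1) ((hmem _ _).2 ⟨⟨h1, by omega, hb⟩, not_le.1 hlt⟩)
    simp only at this
    omega
  have hleft : 0 < a → v ≤ x b - x (a - 1) := by
    intro ha
    by_contra hlt
    have := hmax (a - 1, b) ((hmem _ _).2 ⟨⟨by omega, h2, h3⟩, not_le.1 hlt⟩)
    simp only at this
    omega
  have k1 := hx 0 a (by omega) (by omega)
  have k2 := hx b m h3 le_rfl
  have k3 := hx a m (by omega) le_rfl
  have k4 := hx 0 b (by omega) h3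
  refine ⟨a, b, h1, h2, h3, h4, le_min ?_ ?_⟩
  · rcases h3.lt_or_eq with hb | rfl
    · have e : xExt m x ((b : ℤ) + 1) = x (b + 1) := by
        rw [xExt, if_neg (by omega), if_neg (by omega)]
        rfl
      rw [e]
      exact hright hb
    · rw [xExt, if_neg (by omega), if_pos (by omega)]
      rcases Nat.eq_zero_or_pos a with rfl | ha
      · linarith
      · have := hleft ha
        have := hx 0 (a - 1) (by omega) (by omega)
        linarith
  · rcases Nat.eq_zero_or_pos a with rfl | ha
    · rw [xExt, if_pos (by simp)]
      rcases h3.lt_or_eq with hb | rfl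
      · have := hright hb
        have := hx (b + 1) m hb le_rfl
        linarith
      · linarith
    · have e : xExt m x ((a : ℤ) - 1) = x (a - 1) := by
        rw [xExt, if_neg (by omega), if_neg (by omega)]
        congr 1
        omega
      rw [e]
      exact hleft ha

theorem div_max_le_two_mul_div {v y z w : ℝ} (hv : 0 < v) (hw : 0 < w)
    (h : w ≤ v + |y - z|) : v / max v |y - z| ≤ 2 * v / w := by
  rw [div_le_div_iff₀ (lt_max_of_lt_left hv) hw]
  have h1 := le_max_left v |y - z|
  have h2 := le_max_right v |y - z|
  nlinarith

theorem knotWeight_le_pow_div (hx : ∀ i j, i ≤ j → j ≤ m → x i ≤ x j) {a p b : ℕ} (hap : a ≤ p)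
    (hpb : p ≤ b) (hbm : b ≤ m) (hlt : x a < x b) {v : ℝ} (hv : x b - x a < v) :
    knotWeight (Finset.range (m + 1)) (fun i => |x i - x p|) v ≤
      2 ^ (m + 1) * v ^ (a + (m - b)) /
        ((∏ i ∈ Finset.range a, (x b - x i)) * ∏ i ∈ Finset.Ioc b m, (x i - x a)) := by
  have hv0 : 0 < v := (sub_pos.2 hlt).trans hv
  have hxp := hx a p hap (hpb.trans hbm)
  have hxb := hx p b hpb hbm
  have hdisj : Disjoint (Finset.range a) (Finset.Ioc b m) := by
    refine Finset.disjoint_left.2 fun i hi hi' => ?_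
    have := Finset.mem_range.1 hi
    have := (Finset.mem_Ioc.1 hi').1
    omega
  have hsub : Finset.range a ∪ Finset.Ioc b m ⊆ Finset.range (m + 1) := by
    intro i hi
    simp only [Finset.mem_union, Finset.mem_range, Finset.mem_Ioc] at hi ⊢
    omega
  have hnn : ∀ i, 0 ≤ v / max v |x i - x p| := fun i =>
    (div_pos hv0 (lt_max_of_lt_left hv0)).le
  have h1 : knotWeight (Finset.range (m + 1)) (fun i => |x i - x p|) v ≤
      ∏ i ∈ Finset.range a ∪ Finset.Ioc b m, v / max v |x i - x p| := by
    rw [knotWeight, ← Finset.prod_sdiff hsub]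
    refine mul_le_of_le_one_left (Finset.prod_nonneg fun i _ => hnn i) ?_
    exact Finset.prod_le_one (fun i _ => hnn i) fun i _ =>
      (div_le_one (lt_max_of_lt_left hv0)).2 (le_max_left _ _)
  have h2 : ∏ i ∈ Finset.range a, v / max v |x i - x p| ≤
      ∏ i ∈ Finset.range a, 2 * v / (x b - x i) := by
    refine Finset.prod_le_prod (fun i _ => hnn i) fun i hi => ?_
    have hi' := Finset.mem_range.1 hi
    have := hx i a hi'.le (by omega)
    refine div_max_le_two_mul_div hv0 (by linarith) ?_
    have := neg_abs_le (x i - x p)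
    linarith
  have h3 : ∏ i ∈ Finset.Ioc b m, v / max v |x i - x p| ≤
      ∏ i ∈ Finset.Ioc b m, 2 * v / (x i - x a) := by
    refine Finset.prod_le_prod (fun i _ => hnn i) fun i hi => ?_
    have hi' := Finset.mem_Ioc.1 hi
    have := hx b i hi'.1.le hi'.2
    refine div_max_le_two_mul_div hv0 (by linarith) ?_
    have := le_abs_self (x i - x p)
    linarith
  have hP : 0 < ∏ i ∈ Finset.range a, (x b - x i) := by
    refine Finset.prod_pos fun i hi => ?_
    have := hx i a (Finset.mem_range.1 hi).le (by omega)
    linarith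
  have hQ : 0 < ∏ i ∈ Finset.Ioc b m, (x i - x a) := by
    refine Finset.prod_pos fun i hi => ?_
    have hi' := Finset.mem_Ioc.1 hi
    have := hx b i hi'.1.le hi'.2
    linarith
  rw [Finset.prod_union hdisj] at h1
  refine h1.trans ((mul_le_mul h2 h3 (Finset.prod_nonneg fun i _ => hnn i)
    ((Finset.prod_nonneg fun i _ => hnn i).trans h2)).trans ?_)
  rw [Finset.prod_div_distrib, Finset.prod_div_distrib, Finset.prod_const, Finset.prod_const,
    Finset.card_range, Nat.card_Ioc, div_mul_div_comm, ← pow_add, mul_pow]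
  have : (2 : ℝ) ^ (a + (m - b)) ≤ 2 ^ (m + 1) :=
    pow_le_pow_right₀ one_le_two (by omega)
  have := mul_pos hP hQ
  gcongr

theorem integrableOn_zpow_mul {a b : ℝ} (ha : 0 < a) (hφ : Monotone φ) (hφ0 : ∀ t, 0 ≤ φ t)
    {p q : ℕ} (hpq : p + r + 1 ≤ q) :
    MeasureTheory.IntegrableOn (fun u => u ^ ((p : ℤ) + r - q - 1) * φ u) (Set.Ioc a b) := by
  have h := integrableOn_Ioc_mul_div_pow (κ := fun _ => 1) (M := φ b) (n := q + 1 - p - r) (b := b)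
    ha hφ.measurable measurable_const
    (fun v hv => by rw [abs_of_nonneg (hφ0 v)]; exact hφ hv.2) (fun v _ => by simp)
  refine h.congr_fun (fun v _ => ?_) measurableSet_Ioc
  have e : (p : ℤ) + r - q - 1 = -((q + 1 - p - r : ℕ) : ℤ) := by omega
  simp only [e, zpow_neg, zpow_natCast, mul_one]
  rw [div_eq_inv_mul]

theorem Lam_denom_nonneg (hx : ∀ i j, i ≤ j → j ≤ m → x i ≤ x j) {p q : ℕ} (hpq : p ≤ q)
    (hq : q ≤ m) :
    0 ≤ (∏ i ∈ Finset.range p, (x q - x i)) * ∏ i ∈ Finset.Ioc q m, (x i - x p) := by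
  refine mul_nonneg (Finset.prod_nonneg fun i hi => ?_) (Finset.prod_nonneg fun i hi => ?_)
  · exact sub_nonneg.2 (hx i q ((Finset.mem_range.1 hi).le.trans hpq) hq)
  · have hi' := Finset.mem_Ioc.1 hi
    exact sub_nonneg.2 (hx p i (hpq.trans hi'.1.le) hi'.2)

theorem Lam_le_LamMax {p q : ℕ} (hq : q ≤ m) (hpq : p + r + 1 ≤ q) :
    Lam m r x φ p q ≤ LamMax m r x φ := by
  refine le_csSup (Set.Finite.bddAbove ?_) ⟨p, q, hq, hpq, rfl⟩
  refine ((Finset.range (m + 1) ×ˢ Finset.range (m + 1)).finite_toSet.image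
    fun c => Lam m r x φ c.1 c.2).subset ?_
  rintro v ⟨a, b, hb, hab, rfl⟩
  refine ⟨(a, b), ?_, rfl⟩
  simp only [Finset.coe_product, Finset.coe_range, Set.mem_prod, Set.mem_Iio]
  omega

theorem knotTerm_le_LamMax {n : ℕ} (hm : m = r + n) (hx : ∀ i j, i ≤ j → j ≤ m → x i ≤ x j)
    (hxr : ∀ j, j + r + 1 ≤ m → x j < x (j + r + 1)) (hφ : Monotone φ) (hφ0 : ∀ t, 0 ≤ φ t)
    {p : ℕ} (hp : p + r + 1 ≤ m) :
    knotTerm m r n x φ p ≤ 2 ^ (m + 1) * (((m + 1) * (m + 1) : ℕ) * LamMax m r x φ) := by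
  let S : Finset (ℕ × ℕ) := (Finset.range (m + 1) ×ˢ Finset.range (m + 1)).filter
    fun c => c.1 + r + 1 ≤ c.2
  have hS : ∀ c ∈ S, c.2 ≤ m ∧ c.1 + r + 1 ≤ c.2 := by
    intro c hc
    simp only [S, Finset.mem_filter, Finset.mem_product, Finset.mem_range] at hc
    omega
  have hgap : ∀ a b, b ≤ m → a + r + 1 ≤ b → x a < x b := fun a b hb hab =>
    (hxr a (hab.trans hb)).trans_le (hx _ _ hab hb)
  let I : ℕ × ℕ → Set ℝ := fun c => Set.Ioc (x c.2 - x c.1) (dpq m x c.1 c.2)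
  let G : ℕ × ℕ → ℝ → ℝ := fun c u => u ^ ((c.1 : ℤ) + r - c.2 - 1) * φ u /
    ((∏ i ∈ Finset.range c.1, (x c.2 - x i)) * ∏ i ∈ Finset.Ioc c.2 m, (x i - x c.1))
  have hG0 : ∀ c ∈ S, ∀ v, 0 ≤ (I c).indicator (G c) v := by
    intro c hc v
    obtain ⟨h1, h2⟩ := hS c hc
    refine Set.indicator_nonneg (fun u hu => ?_) v
    have hu0 : 0 < u := (sub_pos.2 (hgap _ _ h1 h2)).trans hu.1
    have := hφ0 u
    have := Lam_denom_nonneg hx (by omega : c.1 ≤ c.2) h1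
    positivity
  have hGi : ∀ c ∈ S, MeasureTheory.Integrable ((I c).indicator (G c)) := by
    intro c hc
    obtain ⟨h1, h2⟩ := hS c hc
    refine (MeasureTheory.integrable_indicator_iff measurableSet_Ioc).2 ?_
    exact (integrableOn_zpow_mul (sub_pos.2 (hgap _ _ h1 h2)) hφ hφ0 h2).div_const _
  have hGint : ∀ c, ∫ v, (I c).indicator (G c) v = Lam m r x φ c.1 c.2 := by
    intro c
    rw [MeasureTheory.integral_indicator measurableSet_Ioc, MeasureTheory.integral_div, Lam]
  have hLam0 : ∀ c ∈ S, 0 ≤ Lam m r x φ c.1 c.2 := fun c hc => by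
    rw [← hGint]
    exact MeasureTheory.integral_nonneg (hG0 c hc)
  have hL0 : 0 ≤ LamMax m r x φ := by
    have hc : (p, p + r + 1) ∈ S := by
      simp only [S, Finset.mem_filter, Finset.mem_product, Finset.mem_range]
      omega
    exact (hLam0 _ hc).trans (Lam_le_LamMax hp le_rfl)
  have hpt : ∀ v, (Set.Ioc (x (p + r + 1) - x p) (2 * (x m - x 0))).indicator
      (fun v => φ v / v ^ (n + 1) *
        knotWeight (Finset.range (m + 1)) (fun i => |x i - x p|) v) v ≤
      2 ^ (m + 1) * ∑ c ∈ S, (I c).indicator (G c) v := by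
    intro v
    by_cases hv : v ∈ Set.Ioc (x (p + r + 1) - x p) (2 * (x m - x 0))
    · have hv0 : 0 < v := (sub_pos.2 (hxr p hp)).trans hv.1
      obtain ⟨a, b, h1, h2, h3, h4, h5⟩ := exists_pair_lt_le_dpq hx hp hv.1 hv.2
      have hab : (a, b) ∈ S := by
        simp only [S, Finset.mem_filter, Finset.mem_product, Finset.mem_range]
        omega
      have hle := Finset.single_le_sum (fun c hc => hG0 c hc v) hab
      rw [Set.indicator_of_mem (show v ∈ I (a, b) from ⟨h4, h5⟩)] at hle
      rw [Set.indicator_of_mem hv]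
      refine le_trans ?_ (mul_le_mul_of_nonneg_left hle (by positivity))
      have hw := knotWeight_le_pow_div hx h1 (by omega : p ≤ b) h3
        (hgap a b h3 (by omega)) h4
      have hc : 0 ≤ φ v / v ^ (n + 1) := div_nonneg (hφ0 v) (by positivity)
      refine (mul_le_mul_of_nonneg_left hw hc).trans (le_of_eq ?_)
      have e : v ^ ((a : ℤ) + r - b - 1) = v ^ (a + (m - b)) / v ^ (n + 1) := by
        rw [← zpow_natCast, ← zpow_natCast, ← zpow_sub₀ hv0.ne']
        congr 1
        omega
      simp only [G, e]
      ring
    · rw [Set.indicator_of_notMem hv]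
      exact mul_nonneg (by positivity) (Finset.sum_nonneg fun c hc => hG0 c hc v)
  rw [knotTerm, ← MeasureTheory.integral_indicator measurableSet_Ioc]
  refine (MeasureTheory.integral_mono_of_nonneg (Filter.Eventually.of_forall fun v => ?_)
    ((MeasureTheory.integrable_finsetSum S hGi).const_mul _)
    (Filter.Eventually.of_forall hpt)).trans ?_
  · refine Set.indicator_nonneg (fun u hu => ?_) v
    have hu0 : 0 < u := (sub_pos.2 (hxr p hp)).trans hu.1
    have := hφ0 u
    have := (knotWeight_pos (s := Finset.range (m + 1)) (D := fun i => |x i - x p|) hu0).le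
    positivity
  · rw [MeasureTheory.integral_const_mul, MeasureTheory.integral_finsetSum S hGi]
    refine mul_le_mul_of_nonneg_left ?_ (by positivity)
    calc ∑ c ∈ S, ∫ v, (I c).indicator (G c) v ≤ ∑ c ∈ S, LamMax m r x φ :=
          Finset.sum_le_sum fun c hc => by
            rw [hGint]
            exact Lam_le_LamMax (hS c hc).1 (hS c hc).2
      _ = S.card * LamMax m r x φ := by rw [Finset.sum_const, nsmul_eq_mul]
      _ ≤ _ := by
          refine mul_le_mul_of_nonneg_right (Nat.cast_le.2 ?_) hL0
          refine (Finset.card_filter_le _ _).trans ?_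
          simp

end LamEstimates

section SmoothOmega

variable {g : ℝ → ℝ} {a b M : ℝ} {n : ℕ}

theorem abs_kSymmDiff_le (hM : ∀ t ∈ Set.Icc a b, |g t| ≤ M) {u x : ℝ} (hu : 0 ≤ u) :
    |kSymmDiff n g u x a b| ≤ 2 ^ n * |M| := by
  rw [kSymmDiff]
  split_ifs with h
  · refine (Finset.abs_sum_le_sum_abs _ _).trans ?_
    have e : (2 : ℝ) ^ n * |M| = ∑ i ∈ Finset.range (n + 1), (n.choose i : ℝ) * |M| := by
      rw [← Finset.sum_mul]
      congr 1
      exact_mod_cast (Nat.sum_range_choose n).symm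
    rw [e]
    refine Finset.sum_le_sum fun i hi => ?_
    have hi' : (i : ℝ) ≤ n := by exact_mod_cast Nat.lt_succ_iff.1 (Finset.mem_range.1 hi)
    rw [abs_mul, abs_mul, abs_pow, abs_neg, abs_one, one_pow, one_mul, Nat.abs_cast]
    refine mul_le_mul_of_nonneg_left ((hM _ ⟨?_, ?_⟩).trans (le_abs_self M)) (Nat.cast_nonneg _)
    · nlinarith [h.1]
    · have : 0 ≤ (i : ℝ) * u := by positivity
      nlinarith [h.2]
  · simp only [abs_zero]
    positivity

theorem bddAbove_smoothOmega (hM : ∀ t ∈ Set.Icc a b, |g t| ≤ M) (t : ℝ) :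
    BddAbove {v : ℝ | ∃ u x : ℝ, 0 < u ∧ u ≤ t ∧ v = |kSymmDiff n g u x a b|} := by
  refine ⟨2 ^ n * |M|, ?_⟩
  rintro v ⟨u, x, hu, -, rfl⟩
  exact abs_kSymmDiff_le hM hu.le

theorem smoothOmega_nonneg (t : ℝ) : 0 ≤ smoothOmega n g t a b := by
  refine Real.sSup_nonneg ?_
  rintro v ⟨u, x, -, -, rfl⟩
  exact abs_nonneg _

theorem monotone_smoothOmega (hM : ∀ t ∈ Set.Icc a b, |g t| ≤ M) :
    Monotone fun t => smoothOmega n g t a b := by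
  intro s t hst
  refine Real.sSup_le ?_ (smoothOmega_nonneg t)
  rintro v ⟨u, x, hu, hus, rfl⟩
  exact le_csSup (bddAbove_smoothOmega hM t) ⟨u, x, hu, hus.trans hst, rfl⟩

theorem abs_fwdDiff_iter_le_smoothOmega (hM : ∀ t ∈ Set.Icc a b, |g t| ≤ M) {u t : ℝ}
    (hu : 0 < u) (hat : a ≤ t) (htb : t + n * u ≤ b) :
    |(fwdDiff u)^[n] g t| ≤ smoothOmega n g u a b := by
  refine le_csSup (bddAbove_smoothOmega hM u) ⟨u, t + n / 2 * u, hu, le_rfl, ?_⟩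
  rw [kSymmDiff, if_pos ⟨by linarith, by linarith⟩, fwdDiff_iter_eq_sum_shift]
  congr 1
  rw [← Finset.sum_range_reflect]
  refine Finset.sum_congr rfl fun i hi => ?_
  have hi' := Nat.lt_succ_iff.1 (Finset.mem_range.1 hi)
  have e1 : n + 1 - 1 - i = n - i := by omega
  have e2 : n - (n - i) = i := by omega
  rw [e1, e2, Nat.choose_symm hi', zsmul_eq_mul, nsmul_eq_mul, Nat.cast_sub hi']
  push_cast
  congr 2
  ring

end SmoothOmega

/-- the main theorem, Theorem 2.2 of the paper. -/
theorem stmt14 (r m : ℕ) (hm : r + 1 ≤ m) :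
    ∃ c : ℝ, 0 < c ∧ ∀ x : ℕ → ℝ,
      (∀ i j : ℕ, i ≤ j → j ≤ m → x i ≤ x j) →
      (∀ j : ℕ, j + r + 1 ≤ m → x j < x (j + r + 1)) →
      ∀ f : ℝ → ℝ, ContDiffOn ℝ r f (Set.Icc (x 0) (x m)) →
        |divDiff (fun j => iteratedDerivWithin j f (Set.Icc (x 0) (x m)))
            (List.ofFn fun i : Fin (m + 1) => x i)| ≤
          c * LamMax m r x
            (fun t => smoothOmega (m - r) (iteratedDerivWithin r f (Set.Icc (x 0) (x m)))
              t (x 0) (x m)) := by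
  obtain ⟨k, rfl⟩ : ∃ k, m = r + k + 1 := ⟨m - r - 1, by omega⟩
  obtain ⟨c, hc, H⟩ := abs_divDiff_le_knotSum r k
  have hN : (0 : ℝ) < ((r + k + 1 + 1) * (r + k + 1 + 1) : ℕ) := by positivity
  refine ⟨c * ((k + 1 : ℕ) * (2 ^ (r + k + 1 + 1) *
    ((r + k + 1 + 1) * (r + k + 1 + 1) : ℕ))), by positivity, fun x hx hxr f hf => ?_⟩
  have hlt : x 0 < x (r + k + 1) :=
    (hxr 0 (by omega)).trans_le (hx _ _ (by omega) le_rfl)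
  have hu := uniqueDiffOn_Icc hlt
  obtain ⟨M, hM⟩ : ∃ M, ∀ t ∈ Set.Icc (x 0) (x (r + k + 1)),
      |iteratedDerivWithin r f (Set.Icc (x 0) (x (r + k + 1))) t| ≤ M :=
    isCompact_Icc.exists_bound_of_continuousOn
      (hf.continuousOn_iteratedDerivWithin le_rfl hu)
  have hkr : r + k + 1 - r = k + 1 := by omega
  rw [hkr]
  have hmono := monotone_smoothOmega (n := k + 1) hM
  refine (H x hx hxr (fun j => iteratedDerivWithin j f (Set.Icc (x 0) (x (r + k + 1)))) ?_
    ⟨M, hM⟩ _ hmono (fun t => smoothOmega_nonneg t)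
    fun u hu t ht htu => abs_fwdDiff_iter_le_smoothOmega hM hu ht htu).trans ?_
  · intro j hj t ht
    have hd := hf.differentiableOn_iteratedDerivWithin (m := j) (by exact_mod_cast hj) hu t ht
    have h := hd.hasDerivWithinAt
    rwa [← iteratedDerivWithin_succ] at h
  rw [mul_assoc c]
  refine mul_le_mul_of_nonneg_left ?_ hc.le
  rw [knotSum]
  refine (Finset.sum_le_card_nsmul _ _ _ fun p hp =>
    knotTerm_le_LamMax (by omega) hx hxr hmono (fun t => smoothOmega_nonneg t)
      (by have := Finset.mem_range.1 hp; omega)).trans (le_of_eq ?_)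
  rw [Finset.card_range, nsmul_eq_mul]
  ring
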